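/- arXiv:2103.12113 — 2 statements merged into one kernel-verified Lean document; each statement's English description precedes it below -/
import Mathlib

section
/- Suppose 1, θ₁, …, θₙ are linearly independent over ℚ and ω < ∞ (which forces λ < ∞). Then λ/λ̂ ≥ max( B(ω,λ), G_sim(λ̂) ), where B(ω,λ) = (1 + λ)/(1 + ω^{−1}). -/
open scoped ENNReal


/-- Solvability of the simultaneous approximation system
`max_{1≤i≤n} |x₀θᵢ - xᵢ| ≤ t^{-γ}`, `0 < |x₀| ≤ t` in integers. -/
def SimSolvable (n : ℕ) (θ : Fin n → ℝ) (γ t : ℝ) : Prop :=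
  ∃ x : Fin (n+1) → ℤ, x 0 ≠ 0 ∧ (|x 0| : ℝ) ≤ t ∧
    ∀ i : Fin n, |(x 0 : ℝ) * θ i - (x i.succ : ℝ)| ≤ t ^ (-γ)

/-- Solvability of the linear form system
`|x₀ + θ₁x₁ + … + θₙxₙ| ≤ t^{-γ}`, `0 < max_{1≤i≤n} |xᵢ| ≤ t` in integers. -/
def LinSolvable (n : ℕ) (θ : Fin n → ℝ) (γ t : ℝ) : Prop :=
  ∃ x : Fin (n+1) → ℤ, (∃ i : Fin n, x i.succ ≠ 0) ∧ (∀ i : Fin n, (|x i.succ| : ℝ) ≤ t) ∧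
    |(x 0 : ℝ) + ∑ i : Fin n, θ i * (x i.succ : ℝ)| ≤ t ^ (-γ)

/-- The regular simultaneous Diophantine exponent `λ(θ) ∈ [0,∞]`. -/
noncomputable def lambdaExp (n : ℕ) (θ : Fin n → ℝ) : ℝ≥0∞ :=
  sSup {e : ℝ≥0∞ | ∃ γ : ℝ, 0 < γ ∧ e = ENNReal.ofReal γ ∧
    ∀ T : ℝ, ∃ t : ℝ, T < t ∧ SimSolvable n θ γ t}

/-- The uniform simultaneous Diophantine exponent `λ̂(θ) ∈ [0,∞]`. -/
noncomputable def lambdaHatExp (n : ℕ) (θ : Fin n → ℝ) : ℝ≥0∞ :=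
  sSup {e : ℝ≥0∞ | ∃ γ : ℝ, 0 < γ ∧ e = ENNReal.ofReal γ ∧
    ∃ T : ℝ, ∀ t : ℝ, T < t → SimSolvable n θ γ t}

/-- The regular linear form Diophantine exponent `ω(θ) ∈ [0,∞]`. -/
noncomputable def omegaExp (n : ℕ) (θ : Fin n → ℝ) : ℝ≥0∞ :=
  sSup {e : ℝ≥0∞ | ∃ γ : ℝ, 0 < γ ∧ e = ENNReal.ofReal γ ∧
    ∀ T : ℝ, ∃ t : ℝ, T < t ∧ LinSolvable n θ γ t}

/-- The uniform linear form Diophantine exponent `ω̂(θ) ∈ [0,∞]`. -/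
noncomputable def omegaHatExp (n : ℕ) (θ : Fin n → ℝ) : ℝ≥0∞ :=
  sSup {e : ℝ≥0∞ | ∃ γ : ℝ, 0 < γ ∧ e = ENNReal.ofReal γ ∧
    ∃ T : ℝ, ∀ t : ℝ, T < t → LinSolvable n θ γ t}
/-- `G_sim(l)`: the largest real root of `g(x) = (1-l)xⁿ - x^{n-1} + l`
(the root set always contains `1`, so the supremum is the largest root). -/
noncomputable def Gsim (n : ℕ) (l : ℝ) : ℝ :=
  sSup {x : ℝ | (1 - l) * x ^ n - x ^ (n - 1) + l = 0}

/-- The sup-norm distance of `(Xθ₁, …, Xθₙ)` to the nearest integer point. -/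
noncomputable def approxErr {n : ℕ} (θ : Fin n → ℝ) (X : ℕ) : ℝ :=
  ‖fun i : Fin n => (X : ℝ) * θ i - round ((X : ℝ) * θ i)‖

/-- The integer point `(X, round (Xθ₁), …, round (Xθₙ))`. -/
noncomputable def approxVec {n : ℕ} (θ : Fin n → ℝ) (X : ℕ) : Fin (n + 1) → ℤ :=
  Fin.cons (X : ℤ) fun i => round ((X : ℝ) * θ i)

/-- The point `approxVec θ X` with rational coordinates. -/
noncomputable def approxVecRat {n : ℕ} (θ : Fin n → ℝ) (X : ℕ) : Fin (n + 1) → ℚ :=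
  fun j => (approxVec θ X j : ℚ)

section Approx

variable {n : ℕ} {θ : Fin n → ℝ}

lemma approxErr_nonneg (θ : Fin n → ℝ) (X : ℕ) : 0 ≤ approxErr θ X := norm_nonneg _

lemma abs_sub_round_le_approxErr (θ : Fin n → ℝ) (X : ℕ) (i : Fin n) :
    |(X : ℝ) * θ i - round ((X : ℝ) * θ i)| ≤ approxErr θ X :=
  norm_le_pi_norm (fun i : Fin n => (X : ℝ) * θ i - round ((X : ℝ) * θ i)) i

lemma exists_approxErr_le_of_simSolvable {γ t : ℝ} (h : SimSolvable n θ γ t) :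
    ∃ X : ℕ, 0 < X ∧ (X : ℝ) ≤ t ∧ approxErr θ X ≤ t ^ (-γ) := by
  obtain ⟨x, hx0, hxt, hx⟩ := h
  have ht : 0 ≤ t := le_trans (by positivity) hxt
  have hcast : (((x 0).natAbs : ℕ) : ℝ) = |(x 0 : ℝ)| := by
    rw [Nat.cast_natAbs, Int.cast_abs]
  refine ⟨(x 0).natAbs, Int.natAbs_pos.2 hx0, by rwa [hcast],
    (pi_norm_le_iff_of_nonneg (Real.rpow_nonneg ht _)).2 fun i => ?_⟩
  rw [Real.norm_eq_abs, hcast]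
  rcases abs_choice (x 0 : ℝ) with h | h <;> rw [h]
  · exact (round_le _ (x i.succ)).trans (hx i)
  · refine (round_le _ (-x i.succ)).trans (le_trans (le_of_eq ?_) (hx i))
    rw [← abs_neg]
    push_cast
    ring_nf

lemma simSolvable_of_approxErr_le {γ t : ℝ} {X : ℕ} (hX : 0 < X) (hXt : (X : ℝ) ≤ t)
    (h : approxErr θ X ≤ t ^ (-γ)) : SimSolvable n θ γ t := by
  refine ⟨approxVec θ X, by simpa [approxVec] using hX.ne', by simpa [approxVec] using hXt,
    fun i => ?_⟩
  simpa [approxVec] using (abs_sub_round_le_approxErr θ X i).trans h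

lemma eq_zero_of_add_sum_eq_zero
    (hindep : LinearIndependent ℚ (Fin.cons 1 θ : Fin (n + 1) → ℝ)) {y : Fin (n + 1) → ℚ}
    (h : (y 0 : ℝ) + ∑ i : Fin n, θ i * (y i.succ : ℝ) = 0) : y = 0 := by
  funext j
  refine Fintype.linearIndependent_iff.1 hindep y ?_ j
  rw [Fin.sum_univ_succ]
  simpa [Rat.smul_def, mul_comm] using h

lemma approxErr_pos (hn : 0 < n)
    (hindep : LinearIndependent ℚ (Fin.cons 1 θ : Fin (n + 1) → ℝ)) {X : ℕ} (hX : 0 < X) :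
    0 < approxErr θ X := by
  refine (approxErr_nonneg θ X).lt_of_ne' fun h0 => ?_
  have h := abs_sub_round_le_approxErr θ X ⟨0, hn⟩
  rw [h0, abs_nonpos_iff] at h
  have hy := eq_zero_of_add_sum_eq_zero hindep
    (y := Fin.cons (-(round ((X : ℝ) * θ ⟨0, hn⟩) : ℚ)) (Pi.single ⟨0, hn⟩ (X : ℚ))) (by
      rw [Finset.sum_eq_single ⟨0, hn⟩]
      · simp only [Fin.cons_zero, Fin.cons_succ, Pi.single_eq_same]
        push_cast
        linarith
      · intro i _ hi
        simp [Pi.single_eq_of_ne hi]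
      · simp)
  have := congrFun hy (Fin.succ ⟨0, hn⟩)
  simp only [Fin.cons_succ, Pi.single_eq_same, Pi.zero_apply, Nat.cast_eq_zero] at this
  omega

/-- A point orthogonal to the approximation vectors of arbitrarily large denominators vanishes. -/
lemma eq_zero_of_orthogonal
    (hindep : LinearIndependent ℚ (Fin.cons 1 θ : Fin (n + 1) → ℝ)) {y : Fin (n + 1) → ℚ}
    (h : ∀ N : ℕ, ∃ X ≥ N, ∑ j, approxVecRat θ X j * y j = 0) : y = 0 := by
  refine eq_zero_of_add_sum_eq_zero hindep ?_
  set s : ℝ := (y 0 : ℝ) + ∑ i : Fin n, θ i * (y i.succ : ℝ) with hs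
  set C : ℝ := ∑ i : Fin n, |(y i.succ : ℝ)| with hC
  by_contra hne
  have hpos : 0 < |s| := abs_pos.2 hne
  obtain ⟨N, hN⟩ := exists_nat_gt (C / |s|)
  obtain ⟨X, hXN, hX⟩ := h N
  have hX' : (X : ℝ) * y 0 + ∑ i : Fin n, (round ((X : ℝ) * θ i) : ℝ) * y i.succ = 0 := by
    rw [Fin.sum_univ_succ] at hX
    have := congrArg (fun q : ℚ => (q : ℝ)) hX
    simpa [approxVecRat, approxVec] using this
  have key : (X : ℝ) * s =
      ∑ i : Fin n, ((X : ℝ) * θ i - round ((X : ℝ) * θ i)) * y i.succ := by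
    simp only [sub_mul, Finset.sum_sub_distrib, hs, mul_add, Finset.mul_sum, ← mul_assoc]
    linarith
  have hle : (X : ℝ) * |s| ≤ C := by
    calc (X : ℝ) * |s| = |(X : ℝ) * s| := by rw [abs_mul, Nat.abs_cast]
      _ ≤ ∑ i : Fin n, |((X : ℝ) * θ i - round ((X : ℝ) * θ i)) * y i.succ| := by
        rw [key]; exact Finset.abs_sum_le_sum_abs _ _
      _ ≤ C := Finset.sum_le_sum fun i _ => by
        rw [abs_mul]
        refine mul_le_of_le_one_left (abs_nonneg _) ((abs_sub_round _).trans (by norm_num))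
  have : (N : ℝ) ≤ X := by exact_mod_cast hXN
  rw [div_lt_iff₀ hpos] at hN
  nlinarith

lemma span_eq_top_of_approxVecRat_mem
    (hindep : LinearIndependent ℚ (Fin.cons 1 θ : Fin (n + 1) → ℝ))
    {W : Submodule ℚ (Fin (n + 1) → ℚ)} (h : ∀ N : ℕ, ∃ X ≥ N, approxVecRat θ X ∈ W) :
    W = ⊤ := by
  by_contra hW
  obtain ⟨f, hf, hWf⟩ := Submodule.exists_le_ker_of_lt_top W (lt_top_iff_ne_top.2 hW)
  have hy := eq_zero_of_orthogonal hindep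
    (y := fun i => f fun j => if i = j then 1 else 0) fun N => by
      obtain ⟨X, hX, hXW⟩ := h N
      refine ⟨X, hX, ?_⟩
      have := LinearMap.mem_ker.1 (hWf hXW)
      rw [LinearMap.pi_apply_eq_sum_univ] at this
      simpa using this
  refine hf (LinearMap.ext fun v => ?_)
  rw [LinearMap.pi_apply_eq_sum_univ]
  exact Finset.sum_eq_zero fun i _ => by rw [congrFun hy i]; simp

lemma norm_approxVecRat_le {X : ℕ} (hX : 0 < X) :
    ‖approxVecRat θ X‖ ≤ (1 + ‖θ‖) * X := by
  have hX1 : (1 : ℝ) ≤ X := by exact_mod_cast hX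
  have hθ := norm_nonneg θ
  refine (pi_norm_le_iff_of_nonneg (by positivity)).2 fun j => ?_
  rw [← Rat.norm_cast_real, Real.norm_eq_abs]
  refine Fin.cases ?_ (fun i => ?_) j
  · simp only [approxVecRat, approxVec, Fin.cons_zero, Int.cast_natCast, Rat.cast_natCast,
      Nat.abs_cast]
    nlinarith
  · simp only [approxVecRat, approxVec, Fin.cons_succ, Rat.cast_intCast]
    have h1 := abs_sub_round ((X : ℝ) * θ i)
    have h2 : |(X : ℝ) * θ i| ≤ X * ‖θ‖ := by
      rw [abs_mul, Nat.abs_cast]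
      exact mul_le_mul_of_nonneg_left (norm_le_pi_norm θ i) (by positivity)
    have h3 := abs_sub_abs_le_abs_sub (round ((X : ℝ) * θ i) : ℝ) ((X : ℝ) * θ i)
    rw [abs_sub_comm] at h3
    nlinarith

lemma abs_round_sub_le {X Y : ℕ} (hX : 0 < X) (hXY : X ≤ Y)
    (hL : approxErr θ Y ≤ approxErr θ X) (i : Fin n) :
    |(round ((Y : ℝ) * θ i) : ℝ) - (Y : ℝ) / X * round ((X : ℝ) * θ i)| ≤
      2 * Y * approxErr θ X / X := by
  have hX0 : (0 : ℝ) < X := by exact_mod_cast hX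
  have hYX : (1 : ℝ) ≤ (Y : ℝ) / X := by
    rw [one_le_div hX0]; exact_mod_cast hXY
  have e : (round ((Y : ℝ) * θ i) : ℝ) - (Y : ℝ) / X * round ((X : ℝ) * θ i) =
      (Y : ℝ) / X * ((X : ℝ) * θ i - round ((X : ℝ) * θ i)) -
        ((Y : ℝ) * θ i - round ((Y : ℝ) * θ i)) := by
    field_simp
    ring
  rw [e]
  refine (abs_sub _ _).trans ?_
  rw [abs_mul, abs_of_pos (by linarith : (0 : ℝ) < (Y : ℝ) / X)]
  have h1 := abs_sub_round_le_approxErr θ X i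
  have h2 := abs_sub_round_le_approxErr θ Y i
  have h0 := approxErr_nonneg θ X
  calc _ ≤ (Y : ℝ) / X * approxErr θ X + (Y : ℝ) / X * approxErr θ X := by
        refine add_le_add (mul_le_mul_of_nonneg_left h1 (by linarith)) ?_
        nlinarith
    _ = _ := by ring

lemma norm_approxVecRat_sub_le {X Y : ℕ} (hX : 0 < X) (hXY : X ≤ Y)
    (hL : approxErr θ Y ≤ approxErr θ X) :
    ‖approxVecRat θ Y - ((Y : ℚ) / X) • approxVecRat θ X‖ ≤ 2 * Y * approxErr θ X / X := by
  have h0 := approxErr_nonneg θ X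
  refine (pi_norm_le_iff_of_nonneg (by positivity)).2 fun j => ?_
  rw [← Rat.norm_cast_real, Real.norm_eq_abs]
  refine Fin.cases ?_ (fun i => ?_) j
  · have hX0 : (X : ℝ) ≠ 0 := by exact_mod_cast hX.ne'
    simp only [approxVecRat, approxVec, Pi.sub_apply, Pi.smul_apply, smul_eq_mul, Fin.cons_zero]
    push_cast
    rw [div_mul_cancel₀ _ hX0, sub_self, abs_zero]
    positivity
  · simpa [approxVecRat, approxVec] using abs_round_sub_le hX hXY hL i

end Approx

section Dirichlet

variable {n : ℕ}

/-- Dirichlet's theorem on simultaneous approximation, by the pigeonhole principle. -/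
lemma exists_approxErr_le_inv (θ : Fin n → ℝ) {N : ℕ} (hN : 0 < N) :
    ∃ X : ℕ, 0 < X ∧ X ≤ N ^ n ∧ approxErr θ X ≤ 1 / N := by
  have hN0 : (0 : ℝ) < N := by exact_mod_cast hN
  have hlt : ∀ (a : Fin (N ^ n + 1)) (i : Fin n),
      ⌊(N : ℝ) * Int.fract ((a : ℕ) * θ i)⌋₊ < N := fun a i => by
    rw [Nat.floor_lt (by positivity)]
    nlinarith [Int.fract_lt_one ((a : ℕ) * θ i)]
  obtain ⟨a, b, hab, hf⟩ := Fintype.exists_ne_map_eq_of_card_lt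
    (fun (a : Fin (N ^ n + 1)) (i : Fin n) =>
      (⟨⌊(N : ℝ) * Int.fract ((a : ℕ) * θ i)⌋₊, hlt a i⟩ : Fin N)) (by simp)
  wlog hlt' : a < b generalizing a b
  · exact this b a hab.symm hf.symm (lt_of_le_of_ne (not_lt.1 hlt') hab.symm)
  have hab' : (a : ℕ) < b := hlt'
  refine ⟨(b : ℕ) - a, by omega, by omega,
    (pi_norm_le_iff_of_nonneg (by positivity)).2 fun i => ?_⟩
  have hfl : ⌊(N : ℝ) * Int.fract ((a : ℕ) * θ i)⌋₊ = ⌊(N : ℝ) * Int.fract ((b : ℕ) * θ i)⌋₊ :=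
    congrArg Fin.val (congrFun hf i)
  have hclose : |(N : ℝ) * Int.fract ((b : ℕ) * θ i) - N * Int.fract ((a : ℕ) * θ i)| ≤ 1 := by
    have h1 := Nat.floor_le (a := (N : ℝ) * Int.fract ((a : ℕ) * θ i)) (by positivity)
    have h2 := Nat.lt_floor_add_one ((N : ℝ) * Int.fract ((a : ℕ) * θ i))
    have h3 := Nat.floor_le (a := (N : ℝ) * Int.fract ((b : ℕ) * θ i)) (by positivity)
    have h4 := Nat.lt_floor_add_one ((N : ℝ) * Int.fract ((b : ℕ) * θ i))
    rw [hfl] at h1 h2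
    rw [abs_le]
    constructor <;> linarith
  rw [← mul_sub, abs_mul, Nat.abs_cast] at hclose
  rw [Real.norm_eq_abs, le_div_iff₀ hN0, mul_comm]
  refine le_trans (mul_le_mul_of_nonneg_left ?_ hN0.le) hclose
  refine (round_le _ (⌊(b : ℕ) * θ i⌋ - ⌊(a : ℕ) * θ i⌋)).trans (le_of_eq ?_)
  rw [Nat.cast_sub hab'.le]
  simp only [Int.fract]
  push_cast
  ring_nf

lemma simSolvable_of_large (hn : 0 < n) (θ : Fin n → ℝ) {t : ℝ} (ht : 4 ^ n < t) :
    SimSolvable n θ (1 / (2 * n)) t := by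
  have hn0 : (0 : ℝ) < n := by exact_mod_cast hn
  have ht1 : 1 ≤ t := (one_le_pow₀ (by norm_num : (1 : ℝ) ≤ 4)).trans ht.le
  have ht0 : 0 < t := by linarith
  set s : ℝ := t ^ (1 / (2 * (n : ℝ))) with hs
  have hs1 : 1 ≤ s := Real.one_le_rpow ht1 (by positivity)
  have hsn : s ^ (2 * n) = t := by
    rw [hs, ← Real.rpow_natCast, ← Real.rpow_mul ht0.le]
    push_cast
    rw [one_div_mul_cancel (by positivity), Real.rpow_one]
  have hNpos : 0 < ⌈s⌉₊ := Nat.ceil_pos.2 (by linarith)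
  obtain ⟨X, hX, hXN, hXe⟩ := exists_approxErr_le_inv θ hNpos
  refine simSolvable_of_approxErr_le hX ?_ (hXe.trans ?_)
  · have h2s : (⌈s⌉₊ : ℝ) ≤ 2 * s := by linarith [Nat.ceil_lt_add_one (by linarith : 0 ≤ s)]
    have h2 : (2 : ℝ) ^ n ≤ s ^ n := by
      refine le_of_sq_le_sq ?_ (by positivity)
      calc ((2 : ℝ) ^ n) ^ 2 = 4 ^ n := by rw [← pow_mul, mul_comm, pow_mul]; norm_num
        _ ≤ s ^ (2 * n) := by rw [hsn]; exact ht.le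
        _ = _ := by rw [mul_comm, pow_mul]
    calc (X : ℝ) ≤ (⌈s⌉₊ : ℝ) ^ n := by exact_mod_cast hXN
      _ ≤ (2 * s) ^ n := pow_le_pow_left₀ (by positivity) h2s n
      _ = 2 ^ n * s ^ n := mul_pow _ _ _
      _ ≤ s ^ n * s ^ n := mul_le_mul_of_nonneg_right h2 (by positivity)
      _ = t := by rw [← hsn, two_mul, pow_add]
  · rw [Real.rpow_neg ht0.le, ← hs, one_div]
    exact inv_anti₀ (by linarith) (Nat.le_ceil s)

lemma exists_approxErr_lt (θ : Fin n → ℝ) {ε : ℝ} (hε : 0 < ε) :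
    ∃ X : ℕ, 0 < X ∧ approxErr θ X < ε := by
  obtain ⟨N, hN⟩ := exists_nat_one_div_lt hε
  obtain ⟨X, hX, -, hXe⟩ := exists_approxErr_le_inv θ N.succ_pos
  exact ⟨X, hX, hXe.trans_lt (by exact_mod_cast hN)⟩

lemma linSolvable_one (hn : 0 < n) (θ : Fin n → ℝ) (T : ℝ) :
    ∃ t : ℝ, T < t ∧ LinSolvable n θ 1 t := by
  obtain ⟨i₀⟩ : Nonempty (Fin n) := ⟨⟨0, hn⟩⟩
  obtain ⟨N, hN⟩ := exists_nat_gt T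
  obtain ⟨j, k, hk, hkN, h⟩ :=
    Real.exists_int_int_abs_mul_sub_le (θ i₀) N.succ_pos
  have hkN' : (k : ℝ) ≤ (N.succ : ℝ) := by exact_mod_cast hkN
  refine ⟨N.succ, hN.trans (by exact_mod_cast N.lt_succ_self),
    Fin.cons (-j) (Pi.single i₀ k), ⟨i₀, by simpa using hk.ne'⟩, fun i => ?_, ?_⟩
  · by_cases hi : i = i₀
    · subst hi
      have : (0 : ℝ) < k := by exact_mod_cast hk
      simpa [abs_of_pos this] using hkN'
    · simp only [Fin.cons_succ, Pi.single_eq_of_ne hi]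
      simp
      positivity
  · rw [Finset.sum_eq_single i₀ (fun i _ hi => by simp [Pi.single_eq_of_ne hi]) (by simp)]
    simp only [Fin.cons_zero, Fin.cons_succ, Pi.single_eq_same]
    have e : ((-j : ℤ) : ℝ) + θ i₀ * k = k * θ i₀ - j := by push_cast; ring
    rw [e, Real.rpow_neg_one]
    refine h.trans ?_
    rw [one_div]
    exact inv_anti₀ (by positivity) (by linarith)

end Dirichlet

/-- The denominators of a sequence of best simultaneous approximations to `θ`. -/
structure BestApprox {n : ℕ} (θ : Fin n → ℝ) (X : ℕ → ℕ) : Prop where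
  pos : ∀ k, 0 < X k
  strictMono : StrictMono X
  strictAnti : StrictAnti fun k => approxErr θ (X k)
  le_of_lt : ∀ k Y, 0 < Y → approxErr θ Y < approxErr θ (X k) → X (k + 1) ≤ Y

section BestApprox

variable {n : ℕ} {θ : Fin n → ℝ} {X : ℕ → ℕ}

lemma exists_bestApprox (hpos : ∀ Y : ℕ, 0 < Y → 0 < approxErr θ Y) :
    ∃ X : ℕ → ℕ, BestApprox θ X := by
  classical
  have hex : ∀ Y : {Y : ℕ // 0 < Y}, ∃ Z : ℕ, 0 < Z ∧ approxErr θ Z < approxErr θ Y :=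
    fun Y => exists_approxErr_lt θ (hpos Y Y.2)
  let next : {Y : ℕ // 0 < Y} → {Y : ℕ // 0 < Y} :=
    fun Y => ⟨Nat.find (hex Y), (Nat.find_spec (hex Y)).1⟩
  let x : ℕ → {Y : ℕ // 0 < Y} := fun k => next^[k] ⟨1, one_pos⟩
  have hsucc : ∀ k, x (k + 1) = next (x k) := fun k => Function.iterate_succ_apply' _ _ _
  have hlt : ∀ k, approxErr θ (x (k + 1)) < approxErr θ (x k) := fun k => by
    rw [hsucc]; exact (Nat.find_spec (hex (x k))).2
  have hmin : ∀ k Y, 0 < Y → approxErr θ Y < approxErr θ (x k) → (x (k + 1) : ℕ) ≤ Y :=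
    fun k Y hY h => by rw [hsucc]; exact Nat.find_min' (hex (x k)) ⟨hY, h⟩
  refine ⟨fun k => x k, fun k => (x k).2, strictMono_nat_of_lt_succ fun k => ?_,
    strictAnti_nat_of_succ_lt hlt, hmin⟩
  refine lt_of_le_of_ne ?_ fun h => ?_
  · cases k with
    | zero => exact (x 1).2
    | succ k => exact hmin k _ (x (k + 2)).2 ((hlt (k + 1)).trans (hlt k))
  · have := hlt k
    rw [← h] at this
    exact lt_irrefl _ this

lemma BestApprox.le_self (h : BestApprox θ X) (k : ℕ) : k ≤ X k := h.strictMono.le_apply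

lemma BestApprox.eventually_approxErr_lt (h : BestApprox θ X) {ε : ℝ} (hε : 0 < ε) :
    ∃ k, approxErr θ (X k) < ε := by
  obtain ⟨Y, hY, hYe⟩ := exists_approxErr_lt θ hε
  refine ⟨Y, lt_of_le_of_lt (not_lt.1 fun hlt => ?_) hYe⟩
  have h1 := h.le_of_lt Y Y hY hlt
  have h2 := h.le_self (Y + 1)
  omega

lemma BestApprox.approxErr_le_of_uniform (h : BestApprox θ X)
    (hpos : ∀ Y : ℕ, 0 < Y → 0 < approxErr θ Y) {α γ T : ℝ} (hα : 0 < α) (hαγ : α < γ)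
    (hT : ∀ t, T < t → SimSolvable n θ γ t) :
    ∃ K, ∀ k ≥ K, approxErr θ (X k) ≤ (X (k + 1) : ℝ) ^ (-α) := by
  set M : ℝ := max T 1 with hM
  have hM1 : 1 ≤ M := le_max_right _ _
  have hM0 : 0 < M := by linarith
  obtain ⟨K, hK⟩ := h.eventually_approxErr_lt (Real.rpow_pos_of_pos hM0 (-α))
  refine ⟨K, fun k hk => ?_⟩
  have hL := hpos _ (h.pos k)
  have hLM : approxErr θ (X k) < M ^ (-α) := (h.strictAnti.antitone hk).trans_lt hK
  set t : ℝ := approxErr θ (X k) ^ (-(1 / α)) with ht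
  have hMt : M < t := by
    have := Real.rpow_lt_rpow_of_neg hL hLM (by simpa using hα : -(1 / α) < 0)
    rwa [← Real.rpow_mul hM0.le, neg_mul_neg, mul_one_div_cancel hα.ne', Real.rpow_one] at this
  have htα : t ^ (-α) = approxErr θ (X k) := by
    rw [ht, ← Real.rpow_mul hL.le, neg_mul_neg, one_div_mul_cancel hα.ne', Real.rpow_one]
  obtain ⟨Y, hY, hYt, hYe⟩ :=
    exists_approxErr_le_of_simSolvable (hT t ((le_max_left _ _).trans_lt hMt))
  have hYlt : approxErr θ Y < approxErr θ (X k) := by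
    rw [← htα]
    exact hYe.trans_lt (Real.rpow_lt_rpow_of_exponent_lt (hM1.trans_lt hMt) (by linarith))
  have hXY : (X (k + 1) : ℝ) ≤ Y := by exact_mod_cast h.le_of_lt k Y hY hYlt
  rw [← htα]
  exact Real.rpow_le_rpow_of_nonpos (by exact_mod_cast h.pos (k + 1)) (hXY.trans hYt)
    (by linarith)

lemma BestApprox.lt_approxErr_of_not_solvable (h : BestApprox θ X) {β T : ℝ}
    (hT : ∀ t, T < t → ¬ SimSolvable n θ β t) :
    ∃ K, ∀ k ≥ K, (X k : ℝ) ^ (-β) < approxErr θ (X k) := by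
  obtain ⟨K, hK⟩ := exists_nat_gt T
  refine ⟨K, fun k hk => not_le.1 fun hle => hT (X k) (hK.trans_le ?_)
    (simSolvable_of_approxErr_le (h.pos k) le_rfl hle)⟩
  exact_mod_cast hk.trans (h.le_self k)

end BestApprox

section IntegralFamily

variable {m d : ℕ}

/-- A family of rational vectors is volume-integral when every alternating map that is integral
on integer vectors takes an integer value on it. -/
def VolumeIntegral (r : Fin m → Fin d → ℚ) : Prop :=
  ∀ f : (Fin d → ℚ) [⋀^Fin m]→ₗ[ℚ] ℚ,
    (∀ w : Fin m → Fin d → ℤ, ∃ z : ℤ, f (fun i j => (w i j : ℚ)) = z) → ∃ z : ℤ, f r = z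

lemma volumeIntegral_of_isEmpty (r : Fin 0 → Fin d → ℚ) : VolumeIntegral r := fun f hf => by
  obtain ⟨z, hz⟩ := hf fun i => i.elim0
  exact ⟨z, by rw [← hz]; congr 1; exact Subsingleton.elim _ _⟩

lemma VolumeIntegral.cons {r : Fin m → Fin d → ℚ} (hr : VolumeIntegral r) (y : Fin d → ℤ)
    {v : Fin d → ℚ} (hv : v ∈ Submodule.span ℚ (Set.range r)) :
    VolumeIntegral (Fin.cons ((fun j => (y j : ℚ)) - v) r : Fin (m + 1) → Fin d → ℚ) := by
  intro f hf
  obtain ⟨z, hz⟩ := hr (f.curryLeft fun j => (y j : ℚ)) fun w => by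
    obtain ⟨z, hz⟩ := hf (Fin.cons y w)
    refine ⟨z, ?_⟩
    rw [AlternatingMap.curryLeft_apply_apply, ← hz]
    congr 1
    funext i
    refine Fin.cases ?_ (fun i => ?_) i <;> simp [Matrix.vecCons]
  refine ⟨z, ?_⟩
  have h0 : f.curryLeft v r = 0 := by
    rw [AlternatingMap.curryLeft_apply_apply]
    refine f.map_linearDependent _ fun h => ?_
    exact (linearIndependent_finCons.1 h).2 hv
  have : f (Fin.cons ((fun j => (y j : ℚ)) - v) r) =
      f.curryLeft ((fun j => (y j : ℚ)) - v) r := rfl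
  rw [this, map_sub, AlternatingMap.sub_apply, h0, sub_zero, hz]

lemma VolumeIntegral.one_le {r : Fin d → Fin d → ℚ} (hr : VolumeIntegral r)
    (hli : LinearIndependent ℚ r) : 1 ≤ (d.factorial : ℝ) * ∏ i, ‖r i‖ := by
  obtain ⟨z, hz⟩ := hr Matrix.detRowAlternating fun w =>
    ⟨Matrix.det (Matrix.of w), by
      exact (Int.cast_det (R := ℚ) (Matrix.of w)).symm⟩
  have hdet : Matrix.det (Matrix.of r) = z := hz
  have hne : z ≠ 0 := by
    have hu : IsUnit (Matrix.of r) := Matrix.linearIndependent_rows_iff_isUnit.1 hli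
    rw [Matrix.isUnit_iff_isUnit_det, hdet] at hu
    exact_mod_cast hu.ne_zero
  calc (1 : ℝ) ≤ |(z : ℝ)| := by exact_mod_cast Int.one_le_abs hne
    _ = ‖Matrix.det (Matrix.of r)‖ := by
      rw [hdet, ← Rat.norm_cast_real, Real.norm_eq_abs, Rat.cast_intCast]
    _ ≤ ∑ σ : Equiv.Perm (Fin d), ∏ i, ‖r i‖ := by
      rw [← Matrix.det_transpose, Matrix.det_apply']
      refine (norm_sum_le _ _).trans (Finset.sum_le_sum fun σ _ => ?_)
      have hσ : ‖((Equiv.Perm.sign σ : ℤ) : ℚ)‖ = 1 := by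
        rcases Int.units_eq_one_or (Equiv.Perm.sign σ) with h | h <;> simp [h]
      rw [norm_mul, hσ, one_mul, norm_prod]
      exact Finset.prod_le_prod (fun _ _ => norm_nonneg _) fun i _ => norm_le_pi_norm (r i) (σ i)
    _ = _ := by simp [Fintype.card_perm]

end IntegralFamily

section Ratio

variable {n : ℕ} {θ : Fin n → ℝ} {X : ℕ → ℕ}

/-- Consecutive best approximations starting at index `N` span subspaces whose heights satisfy
`H ≪ X ^ (1 - α(1 + q + ⋯ + q ^ (m - 1)))`. -/
lemma BestApprox.exists_volumeIntegral (h : BestApprox θ X)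
    (hindep : LinearIndependent ℚ (Fin.cons 1 θ : Fin (n + 1) → ℝ))
    {α q : ℝ} {N : ℕ} (hα : 0 ≤ α) (hq : 0 ≤ q)
    (hup : ∀ k ≥ N, approxErr θ (X k) ≤ (X (k + 1) : ℝ) ^ (-α))
    (hgap : ∀ k ≥ N, (X (k + 1) : ℝ) ^ q ≤ X k) {m : ℕ} (hm : m ≤ n)
    (hE : ∀ j < m, α * ∑ i ∈ Finset.range j, q ^ i ≤ 1) :
    ∃ (r : Fin (m + 1) → Fin (n + 1) → ℚ) (k : ℕ), N ≤ k ∧ LinearIndependent ℚ r ∧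
      VolumeIntegral r ∧
      (∀ j, N ≤ j → j ≤ k → approxVecRat θ (X j) ∈ Submodule.span ℚ (Set.range r)) ∧
      ∏ i, ‖r i‖ ≤ (1 + ‖θ‖) * 2 ^ m *
        (X k : ℝ) ^ (1 - α * ∑ i ∈ Finset.range m, q ^ i) := by
  induction m with
  | zero =>
    have hmem : approxVecRat θ (X N) ∈ Submodule.span ℚ
        (Set.range (Fin.cons (approxVecRat θ (X N)) Fin.elim0 : Fin 1 → Fin (n + 1) → ℚ)) :=
      Submodule.subset_span ⟨0, rfl⟩
    refine ⟨Fin.cons (approxVecRat θ (X N)) Fin.elim0, N, le_rfl, ?_, ?_, ?_, ?_⟩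
    · refine LinearIndependent.finCons (linearIndependent_empty_type) fun hmem => ?_
      have h0 : approxVecRat θ (X N) = 0 := by simpa using hmem
      have := congrFun h0 0
      simp only [approxVecRat, approxVec, Fin.cons_zero, Pi.zero_apply, Int.cast_natCast,
        Nat.cast_eq_zero] at this
      exact (h.pos N).ne' this
    · have := (volumeIntegral_of_isEmpty (d := n + 1) Fin.elim0).cons (approxVec θ (X N))
        (Submodule.zero_mem _)
      rwa [sub_zero] at this
    · intro j h1 h2
      rwa [le_antisymm h2 h1]
    · simpa using norm_approxVecRat_le (θ := θ) (h.pos N)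
  | succ m ih =>
    obtain ⟨r, k, hNk, hli, hvol, hmem, hprod⟩ :=
      ih (by omega) fun j hj => hE j (by omega)
    set E : ℝ := 1 - α * ∑ i ∈ Finset.range m, q ^ i with hEdef
    have hE0 : 0 ≤ E := sub_nonneg.2 (hE m (by omega))
    have hE1 : E ≤ 1 := sub_le_self _ (mul_nonneg hα (Finset.sum_nonneg fun i _ => by positivity))
    have hEsucc : 1 - α * ∑ i ∈ Finset.range (m + 1), q ^ i = q * (E - 1) + (1 - α) := by
      rw [Finset.sum_range_succ', hEdef]
      simp only [pow_succ, ← Finset.sum_mul, pow_zero]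
      ring
    have hex : ∃ j, N ≤ j ∧ approxVecRat θ (X j) ∉ Submodule.span ℚ (Set.range r) := by
      by_contra! hall
      have htop := span_eq_top_of_approxVecRat_mem hindep
        (W := Submodule.span ℚ (Set.range r)) fun M =>
        ⟨X (max M N), (le_max_left _ _).trans (h.le_self _), hall _ (le_max_right _ _)⟩
      have hrank := finrank_span_eq_card hli
      rw [htop, finrank_top] at hrank
      simp at hrank
      omega
    classical
    obtain ⟨hNj, hj⟩ := Nat.find_spec hex
    have hbefore : ∀ j, N ≤ j → j < Nat.find hex →
        approxVecRat θ (X j) ∈ Submodule.span ℚ (Set.range r) := fun j h1 h2 => by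
      by_contra h3
      exact Nat.find_min hex h2 ⟨h1, h3⟩
    have hkj : k < Nat.find hex := not_le.1 fun hle => hj (hmem _ hNj hle)
    obtain ⟨l, hl⟩ : ∃ l, Nat.find hex = l + 1 := ⟨Nat.find hex - 1, by omega⟩
    rw [hl] at hj hbefore hkj
    have hkl : k ≤ l := by omega
    have hlmem := hbefore l (by omega) (by omega)
    have hv := Submodule.smul_mem _ ((X (l + 1) : ℚ) / X l) hlmem
    set v := ((X (l + 1) : ℚ) / X l) • approxVecRat θ (X l)
    have hrange : Set.range (Fin.cons (approxVecRat θ (X (l + 1)) - v) r :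
        Fin (m + 2) → Fin (n + 1) → ℚ) =
          insert (approxVecRat θ (X (l + 1)) - v) (Set.range r) := Fin.range_cons _ _
    have hsub : Submodule.span ℚ (Set.range r) ≤ Submodule.span ℚ
        (Set.range (Fin.cons (approxVecRat θ (X (l + 1)) - v) r :
          Fin (m + 2) → Fin (n + 1) → ℚ)) := by
      rw [hrange]; exact Submodule.span_mono (Set.subset_insert _ _)
    refine ⟨Fin.cons (approxVecRat θ (X (l + 1)) - v) r, l + 1, by omega,
      hli.finCons fun hc => hj ?_, hvol.cons (approxVec θ (X (l + 1))) hv, ?_, ?_⟩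
    · simpa using add_mem hc hv
    · intro j h1 h2
      rcases h2.lt_or_eq with h2 | rfl
      · exact hsub (hbefore j h1 h2)
      · have h3 : approxVecRat θ (X (l + 1)) - v ∈ Submodule.span ℚ
            (Set.range (Fin.cons (approxVecRat θ (X (l + 1)) - v) r :
              Fin (m + 2) → Fin (n + 1) → ℚ)) := Submodule.subset_span ⟨0, rfl⟩
        simpa using add_mem h3 (hsub hv)
    · rw [Fin.prod_univ_succ, hEsucc]
      simp only [Fin.cons_zero, Fin.cons_succ]
      have hθ := norm_nonneg θ
      have hXl : (0 : ℝ) < X l := by exact_mod_cast h.pos l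
      have hXl1 : (0 : ℝ) < X (l + 1) := by exact_mod_cast h.pos (l + 1)
      have hXkl : (X k : ℝ) ≤ X l := by exact_mod_cast h.strictMono.monotone hkl
      have hnorm := norm_approxVecRat_sub_le (θ := θ) (h.pos l)
        (h.strictMono.monotone l.le_succ) (h.strictAnti.antitone l.le_succ)
      have h1 : ‖approxVecRat θ (X (l + 1)) - v‖ ≤ 2 * ((X (l + 1) : ℝ) ^ (1 - α) / X l) := by
        refine hnorm.trans ?_
        rw [sub_eq_add_neg, Real.rpow_add hXl1, Real.rpow_one, ← mul_div_assoc, ← mul_assoc]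
        gcongr
        exact hup l (by omega)
      have h2 : (X k : ℝ) ^ E / X l ≤ (X (l + 1) : ℝ) ^ (q * (E - 1)) := by
        calc (X k : ℝ) ^ E / X l ≤ (X l : ℝ) ^ E / X l := by gcongr
          _ = (X l : ℝ) ^ (E - 1) := (Real.rpow_sub_one hXl.ne' E).symm
          _ ≤ ((X (l + 1) : ℝ) ^ q) ^ (E - 1) :=
            Real.rpow_le_rpow_of_nonpos (by positivity) (hgap l (by omega)) (by linarith)
          _ = _ := (Real.rpow_mul hXl1.le _ _).symm
      calc _ ≤ 2 * ((X (l + 1) : ℝ) ^ (1 - α) / X l) * ((1 + ‖θ‖) * 2 ^ m * (X k : ℝ) ^ E) := by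
            gcongr
        _ = (1 + ‖θ‖) * 2 ^ (m + 1) * (((X k : ℝ) ^ E / X l) * (X (l + 1) : ℝ) ^ (1 - α)) := by
            ring
        _ ≤ (1 + ‖θ‖) * 2 ^ (m + 1) *
            ((X (l + 1) : ℝ) ^ (q * (E - 1)) * (X (l + 1) : ℝ) ^ (1 - α)) := by gcongr
        _ = _ := by rw [← Real.rpow_add hXl1]

lemma BestApprox.mul_geom_sum_le_one (h : BestApprox θ X) (hn : 2 ≤ n)
    (hindep : LinearIndependent ℚ (Fin.cons 1 θ : Fin (n + 1) → ℝ))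
    {α q : ℝ} {K : ℕ} (hα : 0 < α) (hq : 0 < q)
    (hup : ∀ k ≥ K, approxErr θ (X k) ≤ (X (k + 1) : ℝ) ^ (-α))
    (hgap : ∀ k ≥ K, (X (k + 1) : ℝ) ^ q ≤ X k) :
    α * ∑ i ∈ Finset.range n, q ^ i ≤ 1 := by
  by_contra! hgt
  set S : ℝ := ∑ i ∈ Finset.range (n - 1), q ^ i with hS
  have hSpos : 0 < S := Finset.sum_pos (fun i _ => by positivity) ⟨0, by simp; omega⟩
  have hSn : ∑ i ∈ Finset.range n, q ^ i = S + q ^ (n - 1) := by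
    rw [hS, ← Finset.sum_range_succ, Nat.sub_add_cancel (by omega)]
  -- shrinking `α` makes all the earlier exponents nonnegative
  obtain ⟨a, ha, haα, haS, hagt⟩ : ∃ a, 0 < a ∧ a ≤ α ∧ a * S ≤ 1 ∧
      1 < a * ∑ i ∈ Finset.range n, q ^ i := by
    rcases le_total (α * S) 1 with hle | hle
    · exact ⟨α, hα, le_rfl, hle, hgt⟩
    · refine ⟨1 / S, by positivity, ?_, ?_, ?_⟩
      · rwa [div_le_iff₀ hSpos]
      · rw [one_div_mul_cancel hSpos.ne']
      · rw [hSn, mul_add, one_div_mul_cancel hSpos.ne']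
        have : 0 < 1 / S * q ^ (n - 1) := by positivity
        linarith
  set e : ℝ := a * ∑ i ∈ Finset.range n, q ^ i - 1 with he
  have he0 : 0 < e := by linarith
  set C : ℝ := ((n + 1).factorial : ℝ) * ((1 + ‖θ‖) * 2 ^ n) with hC
  have hθ := norm_nonneg θ
  have hC0 : 0 < C := by positivity
  have hbound : ∀ N : ℕ, K ≤ N → 1 ≤ N → 1 ≤ C * (N : ℝ) ^ (-e) := by
    intro N hKN hN1
    obtain ⟨r, k, hNk, hli, hvol, -, hprod⟩ := h.exists_volumeIntegral hindep ha.le hq.le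
      (N := N) (m := n) (fun k hk => (hup k (hKN.trans hk)).trans
        (Real.rpow_le_rpow_of_exponent_le (by exact_mod_cast h.pos (k + 1)) (by linarith)))
      (fun k hk => hgap k (hKN.trans hk)) le_rfl fun j hj => by
        refine le_trans (mul_le_mul_of_nonneg_left ?_ ha.le) haS
        exact Finset.sum_le_sum_of_subset_of_nonneg
          (Finset.range_subset_range.2 (by omega)) fun i _ _ => by positivity
    have hN0 : (0 : ℝ) < N := by exact_mod_cast hN1
    calc (1 : ℝ) ≤ ((n + 1).factorial : ℝ) * ∏ i, ‖r i‖ := hvol.one_le hli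
      _ ≤ ((n + 1).factorial : ℝ) * ((1 + ‖θ‖) * 2 ^ n *
          (X k : ℝ) ^ (1 - a * ∑ i ∈ Finset.range n, q ^ i)) := by gcongr
      _ = C * (X k : ℝ) ^ (-e) := by rw [hC, he, neg_sub]; ring
      _ ≤ C * (N : ℝ) ^ (-e) := by
        refine mul_le_mul_of_nonneg_left ?_ hC0.le
        exact Real.rpow_le_rpow_of_nonpos hN0 (by exact_mod_cast hNk.trans (h.le_self k))
          (by linarith)
  have hlim : Filter.Tendsto (fun N : ℕ => C * (N : ℝ) ^ (-e)) Filter.atTop (nhds 0) := by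
    simpa using ((tendsto_rpow_neg_atTop he0).comp tendsto_natCast_atTop_atTop).const_mul C
  obtain ⟨N, h1, h2, h3⟩ := ((hlim.eventually_lt_const one_pos).and
    ((Filter.eventually_ge_atTop K).and (Filter.eventually_ge_atTop 1))).exists
  exact absurd (hbound N h2 h3) (not_le.2 h1)

end Ratio

section Transference

variable {n : ℕ} {θ : Fin n → ℝ} {X : ℕ → ℕ}

lemma sum_approxVec_mul (θ : Fin n → ℝ) (Y : ℕ) (y : Fin (n + 1) → ℤ) :
    ((∑ j, approxVec θ Y j * y j : ℤ) : ℝ) =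
      Y * y 0 + ∑ i : Fin n, (round ((Y : ℝ) * θ i) : ℝ) * y i.succ := by
  rw [Fin.sum_univ_succ]
  simp [approxVec]

lemma abs_sum_approxVec_mul_le {Y : ℕ} {y : Fin (n + 1) → ℤ} {t ε : ℝ}
    (hy : ∀ i : Fin n, (|y i.succ| : ℝ) ≤ t)
    (hε : |(y 0 : ℝ) + ∑ i : Fin n, θ i * (y i.succ : ℝ)| ≤ ε) :
    |((∑ j, approxVec θ Y j * y j : ℤ) : ℝ)| ≤ Y * ε + n * t * approxErr θ Y := by
  have e : ((∑ j, approxVec θ Y j * y j : ℤ) : ℝ) =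
      Y * ((y 0 : ℝ) + ∑ i : Fin n, θ i * (y i.succ : ℝ)) -
        ∑ i : Fin n, ((Y : ℝ) * θ i - round ((Y : ℝ) * θ i)) * y i.succ := by
    rw [sum_approxVec_mul]
    simp only [sub_mul, Finset.sum_sub_distrib, mul_add, Finset.mul_sum, ← mul_assoc]
    ring
  rw [e]
  refine (abs_sub _ _).trans (add_le_add ?_ ?_)
  · rw [abs_mul, Nat.abs_cast]
    exact mul_le_mul_of_nonneg_left hε (by positivity)
  · refine (Finset.abs_sum_le_sum_abs _ _).trans ?_
    calc _ ≤ ∑ _i : Fin n, t * approxErr θ Y := Finset.sum_le_sum fun i _ => by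
          rw [abs_mul, mul_comm]
          exact mul_le_mul (hy i) (abs_sub_round_le_approxErr θ Y i) (abs_nonneg _)
            ((abs_nonneg _).trans (hy i))
      _ = _ := by simp [mul_assoc]

/-- If `y` annihilates `approxVec θ Y` but not `approxVec θ Z`, contracting the wedge product of
these two vectors with `y` bounds `Y`. -/
lemma le_of_orthogonal_of_not_orthogonal {Y Z : ℕ} (hY : 0 < Y) (hYZ : Y ≤ Z)
    (hL : approxErr θ Z ≤ approxErr θ Y) {y : Fin (n + 1) → ℤ} {t : ℝ}
    (hy : ∀ i : Fin n, (|y i.succ| : ℝ) ≤ t)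
    (hYy : ∑ j, approxVec θ Y j * y j = 0) (hZy : ∑ j, approxVec θ Z j * y j ≠ 0) :
    (Y : ℝ) ≤ 2 * n * t * Z * approxErr θ Y := by
  have hY0 : (0 : ℝ) < Y := by exact_mod_cast hY
  have h0 : (0 : ℝ) = Y * y 0 + ∑ i : Fin n, (round ((Y : ℝ) * θ i) : ℝ) * y i.succ := by
    rw [← sum_approxVec_mul, hYy, Int.cast_zero]
  have e : ((∑ j, approxVec θ Z j * y j : ℤ) : ℝ) = ∑ i : Fin n,
      ((round ((Z : ℝ) * θ i) : ℝ) - (Z : ℝ) / Y * round ((Y : ℝ) * θ i)) * y i.succ := by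
    rw [sum_approxVec_mul]
    simp only [sub_mul, Finset.sum_sub_distrib, mul_assoc, ← Finset.mul_sum]
    have : ∑ i : Fin n, (round ((Y : ℝ) * θ i) : ℝ) * y i.succ = -(Y * y 0) := by linarith
    rw [this]
    field_simp
    ring
  have h1 : (1 : ℝ) ≤ |((∑ j, approxVec θ Z j * y j : ℤ) : ℝ)| := by
    exact_mod_cast Int.one_le_abs hZy
  have h2 : (1 : ℝ) ≤ n * (2 * Z * approxErr θ Y / Y * t) := by
    refine h1.trans ?_
    rw [e]
    refine (Finset.abs_sum_le_sum_abs _ _).trans ?_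
    calc _ ≤ ∑ _i : Fin n, 2 * Z * approxErr θ Y / Y * t := Finset.sum_le_sum fun i _ => by
          rw [abs_mul]
          have := approxErr_nonneg θ Y
          exact mul_le_mul (abs_round_sub_le hY hYZ hL i) (hy i) (abs_nonneg _) (by positivity)
      _ = _ := by simp
  have e2 : (n : ℝ) * (2 * Z * approxErr θ Y / Y * t) =
      2 * n * t * Z * approxErr θ Y / Y := by ring
  rwa [e2, le_div_iff₀ hY0, one_mul] at h2

lemma BestApprox.mul_one_add_le (h : BestApprox θ X) (hn : 0 < n)
    (hindep : LinearIndependent ℚ (Fin.cons 1 θ : Fin (n + 1) → ℝ))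
    {α δ γ : ℝ} {K : ℕ} (hα : 0 < α) (hδ : 0 ≤ δ) (hγ : 0 < γ) (hαγ : 1 < α * γ)
    (hup : ∀ k ≥ K, approxErr θ (X k) ≤ (X (k + 1) : ℝ) ^ (-α))
    (hlow : ∀ k ≥ K, approxErr θ (X k) ^ (-δ) ≤ X k)
    (hlin : ∀ T : ℝ, ∃ t : ℝ, T < t ∧ LinSolvable n θ γ t) :
    α * (1 + δ) ≤ 1 + 1 / γ := by
  by_contra! hgt
  set η : ℝ := α * (1 + δ) - 1 - 1 / γ with hη
  have hη0 : 0 < η := by linarith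
  have hn0 : (0 : ℝ) < n := by exact_mod_cast hn
  have hn1 : (1 : ℝ) ≤ n := by exact_mod_cast hn
  have hpos : ∀ k, 0 < approxErr θ (X k) := fun k => approxErr_pos hn hindep (h.pos k)
  set C : ℝ := 2 * n * 2 ^ (1 / γ) with hC
  have hγα : 0 < γ - 1 / α := by
    rw [sub_pos, div_lt_iff₀ hα]; linarith
  have ev1 : ∀ᶠ t : ℝ in Filter.atTop, 2 * (2 * n : ℝ) ^ (1 / α) < t ^ (γ - 1 / α) :=
    (tendsto_rpow_atTop hγα).eventually_gt_atTop _
  have ev2 : ∀ᶠ t : ℝ in Filter.atTop, 1 / (2 * n * approxErr θ (X K)) < t :=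
    Filter.eventually_gt_atTop _
  have ev3 : ∀ᶠ t : ℝ in Filter.atTop, C < (t ^ γ / 2) ^ η :=
    ((tendsto_rpow_atTop hη0).comp
      ((tendsto_rpow_atTop hγ).atTop_div_const two_pos)).eventually_gt_atTop _
  obtain ⟨T, hT⟩ := Filter.eventually_atTop.1
    (ev1.and (ev2.and (ev3.and (Filter.eventually_gt_atTop 0))))
  obtain ⟨t, hTt, y, ⟨i₀, hi₀⟩, hy, hyL⟩ := hlin T
  obtain ⟨ht1, ht2, ht3, ht0⟩ := hT t hTt.le
  have hnt : 0 < 2 * n * t := by positivity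
  -- a non-orthogonal approximation of small error has a large denominator
  have hbig : ∀ k, approxErr θ (X k) < 1 / (2 * n * t) →
      ∑ j, approxVec θ (X k) j * y j ≠ 0 → t ^ γ / 2 ≤ X k := by
    intro k hk hne
    have h1 : (1 : ℝ) ≤ |((∑ j, approxVec θ (X k) j * y j : ℤ) : ℝ)| := by
      exact_mod_cast Int.one_le_abs hne
    have h2 := h1.trans (abs_sum_approxVec_mul_le hy hyL)
    rw [lt_div_iff₀ hnt] at hk
    have h3 : 1 / 2 ≤ (X k : ℝ) * t ^ (-γ) := by linarith
    rw [Real.rpow_neg ht0.le, ← div_eq_mul_inv, le_div_iff₀ (by positivity)] at h3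
    linarith
  classical
  have hex := h.eventually_approxErr_lt (ε := 1 / (2 * n * t)) (by positivity)
  set k₀ := Nat.find hex
  have hk₀lt : ∀ k ≥ k₀, approxErr θ (X k) < 1 / (2 * n * t) := fun k hk =>
    (h.strictAnti.antitone hk).trans_lt (Nat.find_spec hex)
  have hKk₀ : K < k₀ := by
    by_contra! hle
    have h1 := hk₀lt K hle
    rw [div_lt_iff₀ (by have := hpos K; positivity)] at ht2
    rw [lt_div_iff₀ hnt] at h1
    linarith
  have horth : ∑ j, approxVec θ (X k₀) j * y j = 0 := by
    by_contra hne
    have h1 := hbig k₀ (hk₀lt k₀ le_rfl) hne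
    obtain ⟨p, hp⟩ : ∃ p, k₀ = p + 1 := ⟨k₀ - 1, by omega⟩
    have h2 : 1 / (2 * n * t) ≤ approxErr θ (X p) :=
      not_lt.1 (Nat.find_min hex (m := p) (by omega))
    have h3 := h2.trans (hup p (by omega))
    rw [← hp] at h3
    have hX0 : (0 : ℝ) < X k₀ := by exact_mod_cast h.pos k₀
    rw [Real.rpow_neg hX0.le, one_div] at h3
    have h4 : (X k₀ : ℝ) ^ α ≤ 2 * n * t := (inv_le_inv₀ hnt (by positivity)).1 h3
    have h5 : (X k₀ : ℝ) ≤ (2 * n * t) ^ (1 / α) := by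
      have := Real.rpow_le_rpow (by positivity) h4 (by positivity : 0 ≤ 1 / α)
      rwa [← Real.rpow_mul hX0.le, mul_one_div_cancel hα.ne', Real.rpow_one] at this
    rw [Real.mul_rpow (by positivity) ht0.le] at h5
    rw [Real.rpow_sub ht0, lt_div_iff₀ (by positivity)] at ht1
    linarith
  have hex2 : ∃ k, k₀ ≤ k ∧ ∑ j, approxVec θ (X k) j * y j ≠ 0 := by
    by_contra! hall
    have h0 := eq_zero_of_orthogonal hindep (y := fun j => (y j : ℚ)) fun N =>
      ⟨X (max N k₀), (le_max_left _ _).trans (h.le_self _), by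
        have := congrArg (fun z : ℤ => (z : ℚ)) (hall (max N k₀) (le_max_right _ _))
        simpa [approxVecRat] using this⟩
    exact hi₀ (by simpa using congrFun h0 i₀.succ)
  obtain ⟨hk₀m, hm⟩ := Nat.find_spec hex2
  obtain ⟨p, hp⟩ : ∃ p, Nat.find hex2 = p + 1 := by
    refine ⟨Nat.find hex2 - 1, ?_⟩
    omega
  rw [hp] at hk₀m hm
  have hk₀p : k₀ ≤ p := by
    by_contra! hlt
    rw [show p + 1 = k₀ by omega] at hm
    exact hm horth
  have hpy : ∑ j, approxVec θ (X p) j * y j = 0 := by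
    by_contra hne
    exact Nat.find_min hex2 (m := p) (by omega) ⟨hk₀p, hne⟩
  have hXm := hbig (p + 1) (hk₀lt _ hk₀m) hm
  have hcon := le_of_orthogonal_of_not_orthogonal (h.pos p) (h.strictMono.monotone p.le_succ)
    (h.strictAnti.antitone p.le_succ) hy hpy hm
  set Z : ℝ := ((X (p + 1) : ℕ) : ℝ) with hZ
  set L : ℝ := approxErr θ (X p) with hL
  have hL0 : 0 < L := hpos p
  have hZ0 : 0 < Z := by rw [hZ]; exact_mod_cast h.pos (p + 1)
  have ht : t ≤ 2 ^ (1 / γ) * Z ^ (1 / γ) := by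
    have h1 : t ^ γ ≤ 2 * Z := by linarith
    have := Real.rpow_le_rpow (by positivity) h1 (by positivity : 0 ≤ 1 / γ)
    rwa [← Real.rpow_mul ht0.le, mul_one_div_cancel hγ.ne', Real.rpow_one,
      Real.mul_rpow (by norm_num) hZ0.le] at this
  have hLZ : Z ^ (α * (1 + δ)) ≤ L ^ (-(1 + δ)) := by
    have := Real.rpow_le_rpow_of_nonpos hL0 (hup p (by omega)) (by linarith : -(1 + δ) ≤ 0)
    rwa [← Real.rpow_mul hZ0.le, neg_mul_neg] at this
  have hLt : L ^ (-(1 + δ)) ≤ 2 * n * t * Z := by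
    have h1 := (hlow p (by omega)).trans hcon
    rw [neg_add, add_comm, Real.rpow_add hL0, Real.rpow_neg_one, ← div_eq_mul_inv,
      div_le_iff₀ hL0]
    exact h1
  have hfin : Z ^ η ≤ C := by
    have h1 : Z ^ (α * (1 + δ)) ≤ C * Z ^ (1 / γ) * Z :=
      calc _ ≤ 2 * n * t * Z := hLZ.trans hLt
        _ ≤ 2 * n * (2 ^ (1 / γ) * Z ^ (1 / γ)) * Z := by gcongr
        _ = _ := by rw [hC]; ring
    rw [hη, Real.rpow_sub hZ0, Real.rpow_sub hZ0, Real.rpow_one, div_div,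
      div_le_iff₀ (by positivity)]
    linarith
  have : (t ^ γ / 2) ^ η ≤ Z ^ η := Real.rpow_le_rpow (by positivity) hXm hη0.le
  linarith

end Transference

section Exponents

variable {n : ℕ} {θ : Fin n → ℝ}

lemma exists_uniform_of_lt_lambdaHatExp {a : ℝ} (ha : 0 ≤ a)
    (h : ENNReal.ofReal a < lambdaHatExp n θ) :
    ∃ γ T : ℝ, a < γ ∧ ∀ t : ℝ, T < t → SimSolvable n θ γ t := by
  obtain ⟨_, ⟨γ, -, rfl, T, hT⟩, hlt⟩ := lt_sSup_iff.1 h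
  exact ⟨γ, T, (ENNReal.ofReal_lt_ofReal_iff_of_nonneg ha).1 hlt, hT⟩

lemma exists_linSolvable_of_lt_omegaExp {a : ℝ} (ha : 0 ≤ a)
    (h : ENNReal.ofReal a < omegaExp n θ) :
    ∃ γ : ℝ, a < γ ∧ ∀ T : ℝ, ∃ t : ℝ, T < t ∧ LinSolvable n θ γ t := by
  obtain ⟨_, ⟨γ, -, rfl, hT⟩, hlt⟩ := lt_sSup_iff.1 h
  exact ⟨γ, (ENNReal.ofReal_lt_ofReal_iff_of_nonneg ha).1 hlt, hT⟩

lemma exists_not_simSolvable_of_lambdaExp_lt {b : ℝ} (h : lambdaExp n θ < ENNReal.ofReal b) :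
    ∃ T : ℝ, ∀ t : ℝ, T < t → ¬ SimSolvable n θ b t := by
  by_contra! hall
  have hb : 0 < b := ENNReal.ofReal_pos.1 (bot_le.trans_lt h)
  exact h.not_ge (le_sSup ⟨b, hb, rfl, hall⟩)

lemma lambdaHatExp_le_lambdaExp (n : ℕ) (θ : Fin n → ℝ) : lambdaHatExp n θ ≤ lambdaExp n θ := by
  refine sSup_le_sSup ?_
  rintro _ ⟨γ, hγ, rfl, T, hT⟩
  exact ⟨γ, hγ, rfl, fun S => ⟨max S T + 1, by linarith [le_max_left S T],
    hT _ (by linarith [le_max_right S T])⟩⟩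

lemma lambdaHatExp_pos (hn : 0 < n) (θ : Fin n → ℝ) : 0 < lambdaHatExp n θ := by
  have hn0 : (0 : ℝ) < n := by exact_mod_cast hn
  refine (ENNReal.ofReal_pos.2 (by positivity : (0 : ℝ) < 1 / (2 * n))).trans_le (le_sSup ?_)
  exact ⟨_, by positivity, rfl, 4 ^ n, fun t ht => simSolvable_of_large hn θ ht⟩

lemma one_le_omegaExp (hn : 0 < n) (θ : Fin n → ℝ) : 1 ≤ omegaExp n θ := by
  rw [← ENNReal.ofReal_one]
  exact le_sSup ⟨1, one_pos, rfl, linSolvable_one hn θ⟩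

lemma lambdaHatExp_lt_top (hn : 0 < n)
    (hindep : LinearIndependent ℚ (Fin.cons 1 θ : Fin (n + 1) → ℝ)) :
    lambdaHatExp n θ < ⊤ := by
  by_contra h
  have hpos : ∀ Y : ℕ, 0 < Y → 0 < approxErr θ Y := fun Y hY => approxErr_pos hn hindep hY
  obtain ⟨X, hX⟩ := exists_bestApprox hpos
  obtain ⟨γ, T, hγ, hT⟩ := exists_uniform_of_lt_lambdaHatExp (n := n) (θ := θ) (a := 3)
    (by norm_num) (by rw [not_lt_top_iff.1 h]; exact ENNReal.ofReal_lt_top)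
  obtain ⟨K, hK⟩ := hX.approxErr_le_of_uniform hpos (by norm_num) hγ hT
  have := hX.mul_one_add_le hn hindep (δ := 0) (by norm_num) le_rfl one_pos (by norm_num) hK
    (fun k _ => by simpa [Nat.one_le_iff_ne_zero] using (hX.pos k).ne') (linSolvable_one hn θ)
  norm_num at this

lemma le_of_gsim_root (hn : 2 ≤ n) {a r x : ℝ} (hr : 1 ≤ r)
    (h : a * ∑ i ∈ Finset.range n, r⁻¹ ^ i ≤ 1)
    (hx : (1 - a) * x ^ n - x ^ (n - 1) + a = 0) : x ≤ r := by
  by_contra! hrx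
  have hx1 : 1 < x := hr.trans_lt hrx
  have hx0 : 0 < x := by linarith
  obtain ⟨m, rfl⟩ : ∃ m, n = m + 1 := ⟨n - 1, by omega⟩
  rw [Nat.add_sub_cancel] at hx
  have hgeom := geom_sum_mul x (m + 1)
  have hroot : a * ∑ i ∈ Finset.range (m + 1), x ^ i = x ^ m := by
    have h1 : (a * ∑ i ∈ Finset.range (m + 1), x ^ i) * (x - 1) = x ^ m * (x - 1) := by
      rw [mul_assoc, hgeom]
      rw [pow_succ] at hx ⊢
      linarith
    exact mul_right_cancel₀ (by linarith) h1
  have hrefl : ∑ i ∈ Finset.range (m + 1), x ^ i =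
      x ^ m * ∑ i ∈ Finset.range (m + 1), x⁻¹ ^ i := by
    rw [← Finset.sum_range_reflect, Finset.mul_sum]
    refine Finset.sum_congr rfl fun i hi => ?_
    have hi' : i ≤ m := Nat.lt_succ_iff.1 (Finset.mem_range.1 hi)
    rw [Nat.add_sub_cancel, inv_pow, pow_sub₀ x hx0.ne' hi']
  have hone : a * ∑ i ∈ Finset.range (m + 1), x⁻¹ ^ i = 1 := by
    rw [hrefl, mul_left_comm] at hroot
    exact mul_left_cancel₀ (pow_pos hx0 m).ne' (hroot.trans (mul_one _).symm)
  have hsumpos : 0 < ∑ i ∈ Finset.range (m + 1), x⁻¹ ^ i :=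
    Finset.sum_pos (fun i _ => by positivity) ⟨0, by simp⟩
  have ha : 0 < a := pos_of_mul_pos_left (by rw [hone]; exact one_pos) hsumpos.le
  have hlt : ∑ i ∈ Finset.range (m + 1), x⁻¹ ^ i < ∑ i ∈ Finset.range (m + 1), r⁻¹ ^ i := by
    have hinv : x⁻¹ < r⁻¹ := inv_strictAnti₀ (by linarith) hrx
    refine Finset.sum_lt_sum (fun i _ => pow_le_pow_left₀ (by positivity) hinv.le i)
      ⟨1, Finset.mem_range.2 (by omega), by simpa using hinv⟩
  nlinarith

variable {X : ℕ → ℕ}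

/-- Best approximations realizing prescribed exponents `a` (uniform) and `b` (regular). -/
structure HasExponents (θ : Fin n → ℝ) (X : ℕ → ℕ) (a b : ℝ) : Prop where
  upper : ∀ α, 0 < α → α < a → ∃ K, ∀ k ≥ K, approxErr θ (X k) ≤ (X (k + 1) : ℝ) ^ (-α)
  lower : ∀ β, b < β → ∃ K, ∀ k ≥ K, (X k : ℝ) ^ (-β) < approxErr θ (X k)

lemma HasExponents.mul_geom_sum_le_one {a b : ℝ} (he : HasExponents θ X a b)
    (h : BestApprox θ X) (hn : 2 ≤ n)
    (hindep : LinearIndependent ℚ (Fin.cons 1 θ : Fin (n + 1) → ℝ)) (ha : 0 < a) (hb : 0 < b) :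
    a * ∑ i ∈ Finset.range n, (b / a)⁻¹ ^ i ≤ 1 := by
  by_contra! hgt
  rw [inv_div] at hgt
  have hcont : ContinuousAt
      (fun ε : ℝ => (a - ε) * ∑ i ∈ Finset.range n, ((a - ε) / (b + ε)) ^ i) 0 := by
    have : b + 0 ≠ 0 := by simpa using hb.ne'
    fun_prop (disch := assumption)
  have ev1 := (hcont.eventually_const_lt (by simpa using hgt)).filter_mono
    (nhdsWithin_le_nhds (s := Set.Ioi 0))
  have ev2 : ∀ᶠ ε : ℝ in nhdsWithin 0 (Set.Ioi 0), ε < a :=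
    (eventually_lt_nhds ha).filter_mono nhdsWithin_le_nhds
  obtain ⟨ε, h1, h2, hε⟩ := (ev1.and (ev2.and self_mem_nhdsWithin)).exists
  have hα : 0 < a - ε := by linarith
  have hβ : 0 < b + ε := by linarith
  obtain ⟨K₁, hK₁⟩ := he.upper (a - ε) hα (by linarith)
  obtain ⟨K₂, hK₂⟩ := he.lower (b + ε) (by linarith)
  refine absurd (h.mul_geom_sum_le_one hn hindep (q := (a - ε) / (b + ε)) (K := max K₁ K₂) hα
    (by positivity) (fun k hk => hK₁ k ((le_max_left _ _).trans hk)) fun k hk => ?_) (not_le.2 h1)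
  have hlt := (hK₂ k ((le_max_right _ _).trans hk)).le.trans
    (hK₁ k ((le_max_left _ _).trans hk))
  have hX0 : (0 : ℝ) < X k := by exact_mod_cast h.pos k
  have hX1 : (0 : ℝ) < X (k + 1) := by exact_mod_cast h.pos (k + 1)
  rw [Real.rpow_neg hX0.le, Real.rpow_neg hX1.le,
    inv_le_inv₀ (by positivity) (by positivity)] at hlt
  have := Real.rpow_le_rpow (by positivity) hlt (by positivity : 0 ≤ 1 / (b + ε))
  rwa [← Real.rpow_mul hX0.le, ← Real.rpow_mul hX1.le, mul_one_div_cancel hβ.ne', Real.rpow_one,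
    mul_one_div] at this

lemma HasExponents.mul_one_add_le {a b w : ℝ} (he : HasExponents θ X a b)
    (h : BestApprox θ X) (hn : 0 < n)
    (hindep : LinearIndependent ℚ (Fin.cons 1 θ : Fin (n + 1) → ℝ)) (ha : 0 < a) (hab : a ≤ b)
    (hw : 0 < w) (hlin : ∀ c, 0 < c → c < w →
      ∃ γ, c < γ ∧ ∀ T : ℝ, ∃ t : ℝ, T < t ∧ LinSolvable n θ γ t) :
    a * (1 + 1 / b) ≤ 1 + 1 / w := by
  have hb : 0 < b := by linarith
  by_contra! hgt
  have haw : 1 < a * w := by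
    by_contra! hle
    have h1 : a ≤ 1 / w := by rwa [le_div_iff₀ hw]
    have h2 : a * (1 / b) ≤ 1 := by rwa [mul_one_div, div_le_one hb]
    linarith
  have hb' : b + 0 ≠ 0 := by simpa using hb.ne'
  have hw' : w - 0 ≠ 0 := by simpa using hw.ne'
  have hcont : ContinuousAt
      (fun ε : ℝ => (a - ε) * (1 + 1 / (b + ε)) - (1 + 1 / (w - ε))) 0 := by
    fun_prop (disch := assumption)
  have hcont2 : ContinuousAt (fun ε : ℝ => (a - ε) * (w - ε)) 0 := by fun_prop
  have ev1 := (hcont.eventually_const_lt (u := 0) (by simpa using hgt)).filter_mono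
    (nhdsWithin_le_nhds (s := Set.Ioi 0))
  have ev2 := (hcont2.eventually_const_lt (u := 1) (by simpa using haw)).filter_mono
    (nhdsWithin_le_nhds (s := Set.Ioi 0))
  have ev3 : ∀ᶠ ε : ℝ in nhdsWithin 0 (Set.Ioi 0), ε < min a w :=
    (eventually_lt_nhds (lt_min ha hw)).filter_mono nhdsWithin_le_nhds
  obtain ⟨ε, h1, h2, h3, hε⟩ := (ev1.and (ev2.and (ev3.and self_mem_nhdsWithin))).exists
  have hα : 0 < a - ε := by linarith [min_le_left a w]
  have hw0 : 0 < w - ε := by linarith [min_le_right a w]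
  have hβ : 0 < b + ε := by linarith
  obtain ⟨γ, hγ, hγlin⟩ := hlin (w - ε) hw0 (by linarith)
  obtain ⟨K₁, hK₁⟩ := he.upper (a - ε) hα (by linarith)
  obtain ⟨K₂, hK₂⟩ := he.lower (b + ε) (by linarith)
  have hmain := h.mul_one_add_le hn hindep (δ := 1 / (b + ε)) (γ := γ) (K := max K₁ K₂) hα
    (by positivity) (by linarith) (by nlinarith) (fun k hk => hK₁ k ((le_max_left _ _).trans hk))
    (fun k hk => by
      have hX0 : (0 : ℝ) < X k := by exact_mod_cast h.pos k
      have := Real.rpow_le_rpow_of_nonpos (by positivity)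
        (hK₂ k ((le_max_right _ _).trans hk)).le
        (by rw [neg_nonpos]; positivity : -(1 / (b + ε)) ≤ 0)
      rwa [← Real.rpow_mul hX0.le, neg_mul_neg, mul_one_div_cancel hβ.ne',
        Real.rpow_one] at this) hγlin
  have : 1 / γ ≤ 1 / (w - ε) := one_div_le_one_div_of_le hw0 hγ.le
  linarith

end Exponents

/-- if `1, θ₁, …, θₙ` are linearly independent over `ℚ` and `ω < ∞` (which
forces `λ < ∞`), then `λ/λ̂ ≥ max(B(ω,λ), G_sim(λ̂))`, where `B(ω,λ) = (1+λ)/(1+ω⁻¹)`. -/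
theorem stmt11 (n : ℕ) (hn : 2 ≤ n) (θ : Fin n → ℝ)
    (hindep : LinearIndependent ℚ (Fin.cons 1 θ : Fin (n+1) → ℝ))
    (hω : omegaExp n θ < ⊤) :
    lambdaExp n θ / lambdaHatExp n θ ≥
      max ((1 + lambdaExp n θ) / (1 + (omegaExp n θ)⁻¹))
        (ENNReal.ofReal (Gsim n (lambdaHatExp n θ).toReal)) := by
  have hn0 : 0 < n := by omega
  have hhat_top := (lambdaHatExp_lt_top hn0 hindep).ne
  have hhat_pos := lambdaHatExp_pos hn0 θ
  rcases eq_or_ne (lambdaExp n θ) ⊤ with hreg | hreg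
  · rw [hreg, ENNReal.top_div_of_ne_top hhat_top]
    exact le_top
  have hle := lambdaHatExp_le_lambdaExp n θ
  have hω1 := one_le_omegaExp hn0 θ
  set a := (lambdaHatExp n θ).toReal
  set b := (lambdaExp n θ).toReal
  set w := (omegaExp n θ).toReal
  have ha_eq : lambdaHatExp n θ = ENNReal.ofReal a := (ENNReal.ofReal_toReal hhat_top).symm
  have hb_eq : lambdaExp n θ = ENNReal.ofReal b := (ENNReal.ofReal_toReal hreg).symm
  have hw_eq : omegaExp n θ = ENNReal.ofReal w := (ENNReal.ofReal_toReal hω.ne).symm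
  have ha : 0 < a := ENNReal.toReal_pos hhat_pos.ne' hhat_top
  have hab : a ≤ b := ENNReal.toReal_mono hreg hle
  have hb : 0 < b := ha.trans_le hab
  have hw : 0 < w := ENNReal.toReal_pos (one_pos.trans_le hω1).ne' hω.ne
  have hpos : ∀ Y : ℕ, 0 < Y → 0 < approxErr θ Y := fun Y hY => approxErr_pos hn0 hindep hY
  obtain ⟨X, hX⟩ := exists_bestApprox hpos
  have hexp : HasExponents θ X a b := by
    refine ⟨fun α hα hαa => ?_, fun β hβ => ?_⟩
    · obtain ⟨γ, T, hγ, hT⟩ := exists_uniform_of_lt_lambdaHatExp hα.le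
        (by rw [ha_eq]; exact (ENNReal.ofReal_lt_ofReal_iff ha).2 hαa)
      exact hX.approxErr_le_of_uniform hpos hα hγ hT
    · obtain ⟨T, hT⟩ := exists_not_simSolvable_of_lambdaExp_lt (n := n) (θ := θ) (b := β)
        (by rw [hb_eq]; exact (ENNReal.ofReal_lt_ofReal_iff (hb.trans hβ)).2 hβ)
      exact hX.lt_approxErr_of_not_solvable hT
  rw [ge_iff_le, ha_eq, hb_eq, hw_eq, ← ENNReal.ofReal_div_of_pos ha]
  refine max_le ?_ (ENNReal.ofReal_le_ofReal ?_)
  · have hB := hexp.mul_one_add_le hX hn0 hindep ha hab hw fun c hc hcw =>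
      exists_linSolvable_of_lt_omegaExp hc.le
        (by rw [hw_eq]; exact (ENNReal.ofReal_lt_ofReal_iff hw).2 hcw)
    rw [← ENNReal.ofReal_inv_of_pos hw, ← ENNReal.ofReal_one,
      ← ENNReal.ofReal_add zero_le_one hb.le, ← ENNReal.ofReal_add zero_le_one (by positivity),
      ← ENNReal.ofReal_div_of_pos (by positivity)]
    refine ENNReal.ofReal_le_ofReal ?_
    rw [div_le_div_iff₀ (by positivity) ha]
    have hmul := mul_le_mul_of_nonneg_left hB hb.le
    have e : b * (a * (1 + 1 / b)) = (1 + b) * a := by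
      field_simp
      ring
    rwa [e, one_div] at hmul
  · refine csSup_le ⟨1, by simp⟩ fun x hx => ?_
    exact le_of_gsim_root hn ((one_le_div ha).2 hab)
      (hexp.mul_geom_sum_le_one hX hn hindep ha hb) hx
end

section
/- Suppose 1, θ₁, …, θₙ are linearly independent over ℚ, ω < ∞, ω̂ < ∞, and λ̂ < 1. Then B(ω,λ) ≥ A(ω̂,λ̂) ≥ min( G_lin(ω̂), G_sim(λ̂) ), where B(ω,λ) = (1 + λ)/(1 + ω^{−1}) and A(ω̂,λ̂) = (1 − ω̂^{−1})/(1 − λ̂). -/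
open scoped ENNReal


/-- `G_lin(w)`: the largest real root of `f(x) = w⁻¹xⁿ - x + (1 - w⁻¹)`
(the root set always contains `1`, so the supremum is the largest root). -/
noncomputable def Glin (n : ℕ) (w : ℝ) : ℝ :=
  sSup {x : ℝ | w⁻¹ * x ^ n - x + (1 - w⁻¹) = 0}

/-- The linear form `y₀ + θ₁y₁ + … + θₙyₙ`. -/
noncomputable def linForm {n : ℕ} (θ : Fin n → ℝ) (y : Fin (n+1) → ℤ) : ℝ :=
  (y 0 : ℝ) + ∑ i : Fin n, θ i * (y i.succ : ℝ)

/-- The distance, in the sup norm, from `qθ` to the nearest integer point. -/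
noncomputable def simErr {n : ℕ} (θ : Fin n → ℝ) (q : ℕ) : ℝ :=
  ‖fun i : Fin n => (q : ℝ) * θ i - (round ((q : ℝ) * θ i) : ℝ)‖

/-- The scalar product of `y` with the integer point `(q, p)`, `p` being the integer point
nearest to `qθ`. -/
noncomputable def pairing {n : ℕ} (θ : Fin n → ℝ) (q : ℕ) (y : Fin (n+1) → ℤ) : ℤ :=
  q * y 0 + ∑ i : Fin n, round ((q : ℝ) * θ i) * y i.succ

theorem simErr_nonneg {n : ℕ} (θ : Fin n → ℝ) (q : ℕ) : 0 ≤ simErr θ q := norm_nonneg _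

theorem abs_sub_round_le_simErr {n : ℕ} (θ : Fin n → ℝ) (q : ℕ) (i : Fin n) :
    |(q : ℝ) * θ i - (round ((q : ℝ) * θ i) : ℝ)| ≤ simErr θ q :=
  norm_le_pi_norm (fun i : Fin n => (q : ℝ) * θ i - (round ((q : ℝ) * θ i) : ℝ)) i

theorem simErr_natAbs_le {n : ℕ} (θ : Fin n → ℝ) (x : Fin (n+1) → ℤ) {r : ℝ} (hr : 0 ≤ r)
    (h : ∀ i : Fin n, |(x 0 : ℝ) * θ i - (x i.succ : ℝ)| ≤ r) :
    simErr θ (x 0).natAbs ≤ r := by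
  refine (pi_norm_le_iff_of_nonneg hr).2 fun i => ?_
  rw [Real.norm_eq_abs]
  rcases Int.natAbs_eq (x 0) with h0 | h0
  · have e : ((x 0).natAbs : ℝ) = (x 0 : ℝ) := by
      conv_rhs => rw [h0]
      simp
    rw [e]
    exact (round_le _ _).trans (h i)
  · have e : ((x 0).natAbs : ℝ) = -(x 0 : ℝ) := by
      conv_rhs => rw [h0]
      simp
    rw [e]
    refine (round_le _ (-(x i.succ))).trans (le_of_eq_of_le ?_ (h i))
    rw [← abs_neg]
    push_cast
    ring_nf

theorem simSolvable_of_simErr_le {n : ℕ} {θ : Fin n → ℝ} {q : ℕ} {γ t : ℝ} (hq : 0 < q)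
    (hqt : (q : ℝ) ≤ t) (h : simErr θ q ≤ t ^ (-γ)) : SimSolvable n θ γ t := by
  refine ⟨Fin.cons (q : ℤ) fun i => round ((q : ℝ) * θ i), ?_, ?_, fun i => ?_⟩
  · simpa using hq.ne'
  · simpa using hqt
  · simpa using (abs_sub_round_le_simErr θ q i).trans h

theorem abs_mul_linForm_sub_pairing_le {n : ℕ} (θ : Fin n → ℝ) (q h : ℕ) (y : Fin (n+1) → ℤ)
    (hy : ∀ i : Fin n, |y i.succ| ≤ h) :
    |(q : ℝ) * linForm θ y - pairing θ q y| ≤ n * simErr θ q * h := by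
  have e : (q : ℝ) * linForm θ y - pairing θ q y =
      ∑ i : Fin n, ((q : ℝ) * θ i - (round ((q : ℝ) * θ i) : ℝ)) * (y i.succ : ℝ) := by
    simp only [linForm, pairing, sub_mul, Finset.sum_sub_distrib, mul_add, Finset.mul_sum]
    push_cast
    simp only [mul_assoc]
    ring
  rw [e]
  calc _ ≤ ∑ i : Fin n, |((q : ℝ) * θ i - (round ((q : ℝ) * θ i) : ℝ)) * (y i.succ : ℝ)| :=
        Finset.abs_sum_le_sum_abs _ _
    _ ≤ ∑ _i : Fin n, simErr θ q * h := by
        refine Finset.sum_le_sum fun i _ => ?_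
        rw [abs_mul]
        have := hy i
        exact mul_le_mul (abs_sub_round_le_simErr θ q i) (by exact_mod_cast this)
          (abs_nonneg _) (simErr_nonneg _ _)
    _ = _ := by simp [mul_assoc]

theorem one_le_of_pairing_ne_zero {n : ℕ} (θ : Fin n → ℝ) (q h : ℕ) (y : Fin (n+1) → ℤ)
    (hy : ∀ i : Fin n, |y i.succ| ≤ h) (hp : pairing θ q y ≠ 0) :
    1 ≤ (q : ℝ) * |linForm θ y| + n * simErr θ q * h := by
  have h1 := abs_mul_linForm_sub_pairing_le θ q h y hy
  have h2 : (1 : ℝ) ≤ |(pairing θ q y : ℝ)| := by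
    exact_mod_cast Int.one_le_abs hp
  have h3 : |(q : ℝ) * linForm θ y| = (q : ℝ) * |linForm θ y| := by
    rw [abs_mul, Nat.abs_cast]
  have h4 := abs_sub_abs_le_abs_sub (pairing θ q y : ℝ) ((q : ℝ) * linForm θ y)
  rw [abs_sub_comm] at h4
  linarith

theorem mul_abs_linForm_le_of_pairing_eq_zero {n : ℕ} (θ : Fin n → ℝ) (q h : ℕ)
    (y : Fin (n+1) → ℤ) (hy : ∀ i : Fin n, |y i.succ| ≤ h) (hp : pairing θ q y = 0) :
    (q : ℝ) * |linForm θ y| ≤ n * simErr θ q * h := by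
  have h1 := abs_mul_linForm_sub_pairing_le θ q h y hy
  rwa [hp, Int.cast_zero, sub_zero, abs_mul, Nat.abs_cast] at h1

theorem linForm_ne_zero {n : ℕ} {θ : Fin n → ℝ}
    (hindep : LinearIndependent ℚ (Fin.cons 1 θ : Fin (n+1) → ℝ)) {y : Fin (n+1) → ℤ}
    (hy : y ≠ 0) : linForm θ y ≠ 0 := by
  intro h0
  apply hy
  have := Fintype.linearIndependent_iff.1 hindep (fun i => (y i : ℚ)) (by
    rw [Fin.sum_univ_succ, ← h0]
    simp [linForm, Algebra.smul_def, mul_comm])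
  funext i
  exact_mod_cast this i

theorem simErr_pos {n : ℕ} (hn : 0 < n) {θ : Fin n → ℝ}
    (hindep : LinearIndependent ℚ (Fin.cons 1 θ : Fin (n+1) → ℝ)) {q : ℕ} (hq : 0 < q) :
    0 < simErr θ q := by
  refine (simErr_nonneg θ q).lt_of_ne' fun h => ?_
  have h1 := abs_sub_round_le_simErr θ q ⟨0, hn⟩
  rw [h] at h1
  have h2 := abs_nonpos_iff.1 h1
  refine linForm_ne_zero hindep (y := Fin.cons (-round ((q : ℝ) * θ ⟨0, hn⟩))
    (Pi.single ⟨0, hn⟩ (q : ℤ))) (fun h3 => ?_) ?_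
  · have h4 := congrFun h3 (Fin.succ ⟨0, hn⟩)
    rw [Fin.cons_succ, Pi.single_eq_same] at h4
    exact hq.ne' (by simpa using h4)
  · simp only [linForm, Fin.cons_zero, Fin.cons_succ]
    rw [Finset.sum_eq_single ⟨0, hn⟩]
    · simp
      linarith
    · intro b _ hb
      simp [hb]
    · simp

/-- A positive function with infimum zero on the positive integers has a sequence of records. -/
theorem exists_records (f : ℕ → ℝ) (hpos : ∀ q, 0 < q → 0 < f q)
    (hsmall : ∀ ε > 0, ∃ q, 0 < q ∧ f q < ε) :
    ∃ X : ℕ → ℕ, StrictMono X ∧ (∀ k, 0 < X k) ∧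
      ∀ k q, 0 < q → q < X (k+1) → f (X k) ≤ f q := by
  classical
  have step : ∀ q : {q : ℕ // 0 < q ∧ ∀ r, 0 < r → r ≤ q → f q ≤ f r},
      ∃ q' : {q : ℕ // 0 < q ∧ ∀ r, 0 < r → r ≤ q → f q ≤ f r},
        q.1 < q'.1 ∧ ∀ r, 0 < r → r < q'.1 → f q.1 ≤ f r := by
    rintro ⟨q, hq, hrec⟩
    have hex := hsmall (f q) (hpos q hq)
    have hmin : ∀ r, 0 < r → r < Nat.find hex → f q ≤ f r := fun r hr hlt =>
      not_lt.1 fun hlt' => Nat.find_min hex hlt ⟨hr, hlt'⟩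
    obtain ⟨h0, h1⟩ := Nat.find_spec hex
    refine ⟨⟨Nat.find hex, h0, fun r hr hle => ?_⟩, ?_, hmin⟩
    · rcases hle.eq_or_lt with h | h
      · rw [h]
      · exact h1.le.trans (hmin r hr h)
    · by_contra! hle
      exact absurd (hrec _ h0 hle) (not_le.2 h1)
  choose next hlt hmin using step
  let q₀ : {q : ℕ // 0 < q ∧ ∀ r, 0 < r → r ≤ q → f q ≤ f r} :=
    ⟨1, one_pos, fun r hr hle => by rw [show r = 1 by omega]⟩
  refine ⟨fun k => (next^[k] q₀).1, strictMono_nat_of_lt_succ fun k => ?_,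
    fun k => (next^[k] q₀).2.1, fun k q hq hlt' => ?_⟩
  · simp only [Function.iterate_succ_apply']
    exact hlt _
  · simp only [Function.iterate_succ_apply'] at hlt'
    exact hmin _ q hq hlt'

/-- Simultaneous approximations `X < X'` that are consecutive records, together with a linear form
of height `h` that is minimal for its size, chosen so that the scalar products between them bound
`X` from above. -/
theorem exists_linked_approximations {n : ℕ} (hn : 0 < n) {θ : Fin n → ℝ}
    (hindep : LinearIndependent ℚ (Fin.cons 1 θ : Fin (n+1) → ℝ))
    (hsim : ∀ ε > 0, ∃ q, 0 < q ∧ simErr θ q < ε)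
    (hlin : ∀ ε > 0, ∃ y : Fin (n+1) → ℤ, (∃ i : Fin n, y i.succ ≠ 0) ∧ |linForm θ y| ≤ ε)
    {K : ℕ} (hK : 0 < K) :
    ∃ (X X' h : ℕ) (y : Fin (n+1) → ℤ), K ≤ X ∧ X < X' ∧ 0 < h ∧
      (∀ q, 0 < q → q < X' → simErr θ X ≤ simErr θ q) ∧
      (∃ i : Fin n, y i.succ ≠ 0) ∧ (∀ i : Fin n, |y i.succ| ≤ h) ∧
      |linForm θ y| ≤ 1 / (2 * K) ∧
      (∀ y' : Fin (n+1) → ℤ, (∃ i : Fin n, y' i.succ ≠ 0) → (∀ i : Fin n, |y' i.succ| < h) →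
        1 / (2 * X) < |linForm θ y'|) ∧
      (X : ℝ) ≤ 2 * n * simErr θ X * h * X' ∧
      (X : ℝ) * |linForm θ y| ≤ 2 * n * simErr θ X * h := by
  classical
  obtain ⟨X, hmono, hXpos, hXrec⟩ :=
    exists_records (simErr θ) (fun q hq => simErr_pos hn hindep hq) hsim
  have hanti : ∀ k, simErr θ (X (k+1)) ≤ simErr θ (X k) := fun k =>
    hXrec (k+1) (X k) (hXpos k) (hmono (by omega))
  have hXK : (K : ℝ) ≤ X K := by exact_mod_cast hmono.id_le K
  have hKpos : (0 : ℝ) < K := by exact_mod_cast hK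
  have hXKpos : (0 : ℝ) < X K := by exact_mod_cast hXpos K
  have hex : ∃ h : ℕ, ∃ y : Fin (n+1) → ℤ, (∃ i : Fin n, y i.succ ≠ 0) ∧
      (∀ i : Fin n, |y i.succ| ≤ h) ∧ |linForm θ y| ≤ 1 / (2 * X K) := by
    obtain ⟨y, hy, hys⟩ := hlin (1 / (2 * X K)) (by positivity)
    refine ⟨∑ i : Fin n, (y i.succ).natAbs, y, hy, fun i => ?_, hys⟩
    rw [Int.abs_eq_natAbs]
    exact_mod_cast Finset.single_le_sum (f := fun i : Fin n => (y i.succ).natAbs)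
      (fun _ _ => Nat.zero_le _) (Finset.mem_univ i)
  obtain ⟨y, hy0, hyh, hys⟩ := Nat.find_spec hex
  have hhmin := fun m => Nat.find_min (m := m) hex
  set h := Nat.find hex
  have hhpos : 0 < h := by
    obtain ⟨i, hi⟩ := hy0
    have := (abs_pos.2 hi).trans_le (hyh i)
    exact_mod_cast this
  have hhposR : (0 : ℝ) < h := by exact_mod_cast hhpos
  have hM : 0 < |linForm θ y| := abs_pos.2 <| linForm_ne_zero hindep fun h0 => by
    obtain ⟨i, hi⟩ := hy0
    simp [h0] at hi
  have hyK : |linForm θ y| ≤ 1 / (2 * K) :=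
    hys.trans (one_div_le_one_div_of_le (by positivity) (by linarith))
  have hmin : ∀ k, K ≤ k → ∀ y' : Fin (n+1) → ℤ, (∃ i : Fin n, y' i.succ ≠ 0) →
      (∀ i : Fin n, |y' i.succ| < h) → 1 / (2 * (X k : ℝ)) < |linForm θ y'| := by
    intro k hk y' hy' hyh'
    have h1 : (X K : ℝ) ≤ X k := by exact_mod_cast hmono.monotone hk
    refine (one_div_le_one_div_of_le (by positivity) (by linarith)).trans_lt
      (not_le.1 fun hle => hhmin (h - 1) (by omega) ⟨y', hy', fun i => ?_, hle⟩)
    have := hyh' i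
    push_cast [Nat.cast_sub (show 1 ≤ h from hhpos)]
    omega
  have hXXK : (X K : ℝ) * |linForm θ y| ≤ 1 / 2 := by
    calc _ ≤ (X K : ℝ) * (1 / (2 * X K)) := by gcongr
      _ = _ := by field_simp
  have hnR : (0 : ℝ) < n := by exact_mod_cast hn
  by_cases hcase : 1 ≤ 2 * n * simErr θ (X K) * h
  · refine ⟨X K, X (K+1), h, y, hmono.id_le K, hmono (by omega), hhpos, hXrec K, hy0, hyh, hyK,
      hmin K le_rfl, ?_, by linarith⟩
    have h1 : (X K : ℝ) ≤ X (K+1) := by exact_mod_cast (hmono (by omega : K < K+1)).le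
    nlinarith
  · have hpK : pairing θ (X K) y = 0 := by
      by_contra hp
      have := one_le_of_pairing_ne_zero θ (X K) h y hyh hp
      push Not at hcase
      linarith
    have hne : ∃ k, pairing θ (X (K + k)) y ≠ 0 := by
      by_contra! hall
      obtain ⟨q, hq, hqs⟩ := hsim (|linForm θ y| / (n * h)) (by positivity)
      have h1 : simErr θ (X (K + q)) ≤ simErr θ q :=
        hXrec _ _ hq ((show q < K + q + 1 by omega).trans_le (hmono.id_le (K + q + 1)))
      have h2 := mul_abs_linForm_le_of_pairing_eq_zero θ _ h y hyh (hall q)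
      have h3 : (1 : ℝ) ≤ X (K + q) := by exact_mod_cast hXpos (K + q)
      rw [lt_div_iff₀ (by positivity)] at hqs
      have h4 : simErr θ (X (K + q)) * (n * h) ≤ simErr θ q * (n * h) := by gcongr
      nlinarith
    have hfirst := Nat.find_spec hne
    have hbefore := fun m => Nat.find_min (m := m) hne
    obtain ⟨k, hk⟩ : ∃ k, Nat.find hne = k + 1 := Nat.exists_eq_succ_of_ne_zero fun h0 => by
      rw [h0] at hfirst
      exact hfirst hpK
    rw [hk] at hfirst hbefore
    have hzero : pairing θ (X (K + k)) y = 0 := not_not.1 (hbefore k (by omega))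
    have h1 := mul_abs_linForm_le_of_pairing_eq_zero θ _ h y hyh hzero
    have h2 := one_le_of_pairing_ne_zero θ _ h y hyh hfirst
    rw [← add_assoc] at h2
    have hlt : X (K + k) < X (K + k + 1) := hmono (by omega)
    have hltR : (X (K + k) : ℝ) < X (K + k + 1) := by exact_mod_cast hlt
    have hX0 : (0 : ℝ) < X (K + k) := by exact_mod_cast hXpos _
    refine ⟨X (K + k), X (K + k + 1), h, y,
      (hmono.id_le K).trans (hmono.monotone (by omega)), hlt, hhpos, hXrec _, hy0, hyh, hyK,
      hmin _ (by omega), ?_, by nlinarith [mul_pos hX0 hM]⟩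
    rcases le_or_gt 1 (2 * n * simErr θ (X (K + k)) * h) with h3 | h3
    · nlinarith
    · have h4 : n * simErr θ (X (K + k + 1)) * h ≤ n * simErr θ (X (K + k)) * h := by
        gcongr
        exact hanti _
      have h5 : 1 ≤ 2 * ((X (K + k + 1) : ℝ) * |linForm θ y|) := by linarith
      calc (X (K + k) : ℝ) ≤ X (K + k) * (2 * ((X (K + k + 1) : ℝ) * |linForm θ y|)) :=
            le_mul_of_one_le_right hX0.le h5
        _ = 2 * X (K + k + 1) * (X (K + k) * |linForm θ y|) := by ring
        _ ≤ 2 * X (K + k + 1) * (n * simErr θ (X (K + k)) * h) := by gcongr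
        _ = _ := by ring

theorem one_add_mul_one_sub_le_of_linked {γ w lam om a l b m Z Y : ℝ} (hγ1 : γ ≤ 1) (hγ0 : 0 < γ)
    (hw : 1 ≤ w) (hom : 0 < om) (ha : 0 < a) (hZ : 0 < Z) (hY : 0 < Y) (hl : 0 < l)
    (hZb : Z ≤ b) (hZm : Z ≤ m) (h1 : l ≤ lam * a) (h2 : w * Y ≤ a) (h3 : γ * b ≤ l)
    (h4 : m ≤ om * Y) (h5 : a + l ≤ Z + Y) :
    (1 + om⁻¹) * (1 - w⁻¹) ≤ (1 + lam) * (1 - γ) := by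
  have e1 : l / a ≤ lam := (div_le_iff₀ ha).2 h1
  have e2 : om⁻¹ ≤ Y / Z := by
    rw [inv_le_iff_one_le_mul₀ hom, div_mul_eq_mul_div, le_div_iff₀ hZ]
    linarith
  have e3 : γ ≤ l / Z := (le_div_iff₀ hZ).2 (by nlinarith)
  have e4 : Y / a ≤ w⁻¹ := by
    rw [div_le_iff₀ ha, ← div_eq_inv_mul, le_div_iff₀ (by linarith)]
    linarith
  have hw1 : w⁻¹ ≤ 1 := inv_le_one_of_one_le₀ hw
  calc (1 + om⁻¹) * (1 - w⁻¹) ≤ (1 + Y / Z) * (1 - w⁻¹) := by gcongr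
    _ ≤ (1 + Y / Z) * (1 - Y / a) := by gcongr
    _ ≤ (1 + l / a) * (1 - l / Z) := by
        rw [← sub_nonneg]
        have : (1 + l / a) * (1 - l / Z) - (1 + Y / Z) * (1 - Y / a) =
            (l + Y) * (Z - a + Y - l) / (a * Z) := by
          field_simp
          ring
        rw [this]
        apply div_nonneg (mul_nonneg _ _) <;> nlinarith
    _ ≤ (1 + l / a) * (1 - γ) := by gcongr
    _ ≤ (1 + lam) * (1 - γ) := by gcongr

theorem exists_one_add_mul_one_sub_le_of_linked {γ γ₁ w w₁ lam lam₁ om c d : ℝ} (hγ1 : γ ≤ 1)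
    (hγ0 : 0 < γ) (hγ : γ < γ₁) (hw1 : 1 ≤ w) (hw : w < w₁) (hlam : lam₁ < lam) (hom : 0 < om)
    (hc : 0 ≤ c) :
    ∃ R, ∀ a l b m Y : ℝ, R ≤ a → a ≤ b → 0 < m → 0 < Y → w₁ * (Y - d) ≤ a + d →
      γ₁ * (b - d) ≤ l → l ≤ lam₁ * a → m ≤ om * Y → a ≤ c - l + Y + b → a - m ≤ c - l + Y →
      (1 + om⁻¹) * (1 - w⁻¹) ≤ (1 + lam) * (1 - γ) := by
  have h1 : 0 < γ₁ - γ := sub_pos.2 hγ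
  have h2 : 0 < w₁ - w := sub_pos.2 hw
  have h3 : 0 < lam - lam₁ := sub_pos.2 hlam
  obtain ⟨R, hR⟩ := ((Set.finite_range ![c + 1, γ₁ * d / (γ₁ - γ), lam * c / (lam - lam₁),
    (w * (d + w₁ * d) + w₁ * c) / (w₁ - w)]).bddAbove)
  have hR0 := hR ⟨0, rfl⟩
  have hR1 := hR ⟨1, rfl⟩
  have hR2 := hR ⟨2, rfl⟩
  have hR3 := hR ⟨3, rfl⟩
  simp only [Matrix.cons_val] at hR0 hR1 hR2 hR3
  rw [div_le_iff₀ (by assumption)] at hR1 hR2 hR3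
  refine ⟨R, fun a l b m Y haR hab hm hY e1 e2 e3 e4 e5 e6 => ?_⟩
  have hb1 : γ * b ≤ l := by nlinarith
  have ha : 0 < a - c := by linarith
  have hb : 0 < b := by linarith
  refine one_add_mul_one_sub_le_of_linked (a := a - c) (l := l) (b := b) (m := m) (Z := min b m)
    (Y := Y) hγ1 hγ0 hw1 hom ha (lt_min hb hm) hY ((mul_pos hγ0 hb).trans_le hb1) (min_le_left _ _)
    (min_le_right _ _) (by nlinarith) ?_ hb1 e4 ?_
  · have h5 : w * (a + d + w₁ * d) ≤ w₁ * (a - c) := by nlinarith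
    have h6 : w₁ * (w * Y) ≤ w₁ * (a - c) := by nlinarith
    exact le_of_mul_le_mul_left h6 (by linarith)
  · rcases min_choice b m with h | h <;> rw [h] <;> linarith

theorem one_add_mul_one_sub_le {n : ℕ} (hn : 0 < n) {θ : Fin n → ℝ}
    (hindep : LinearIndependent ℚ (Fin.cons 1 θ : Fin (n+1) → ℝ))
    {γ γ₁ w w₁ lam lam₁ om : ℝ} (hγ1 : γ ≤ 1)
    (hγ0 : 0 < γ) (hγ : γ < γ₁) (hw1 : 1 ≤ w) (hw : w < w₁) (hlam : lam₁ < lam) (hom : 0 < om)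
    (hS : ∃ T : ℝ, ∀ t, T < t → SimSolvable n θ γ₁ t)
    (hL : ∃ T : ℝ, ∀ t, T < t → LinSolvable n θ w₁ t)
    (hS' : ∃ T : ℝ, ∀ t, T < t → ¬ SimSolvable n θ lam₁ t)
    (hL' : ∃ T : ℝ, ∀ t, T < t → ¬ LinSolvable n θ om t) :
    (1 + om⁻¹) * (1 - w⁻¹) ≤ (1 + lam) * (1 - γ) := by
  obtain ⟨TS, hTS⟩ := hS
  obtain ⟨TL, hTL⟩ := hL
  obtain ⟨TS', hTS'⟩ := hS'
  obtain ⟨TL', hTL'⟩ := hL'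
  have hγ₁ : 0 < γ₁ := by linarith
  have hw₁ : 0 < w₁ := by linarith
  have hsmall : ∀ s : ℝ, 0 < s → ∀ ε > 0, ∀ T : ℝ, ∃ t, T < t ∧ t ^ (-s) < ε := fun s hs ε hε T =>
    ((Filter.eventually_gt_atTop T).and
      ((tendsto_rpow_neg_atTop hs).eventually (gt_mem_nhds hε))).exists
  have hsim : ∀ ε > 0, ∃ q, 0 < q ∧ simErr θ q < ε := by
    intro ε hε
    obtain ⟨t, ht, hte⟩ := hsmall γ₁ hγ₁ ε hε (max TS 0)
    obtain ⟨x, hx0, -, hx⟩ := hTS t ((le_max_left _ _).trans_lt ht)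
    exact ⟨(x 0).natAbs, Int.natAbs_pos.2 hx0, (simErr_natAbs_le θ x
      (Real.rpow_nonneg ((le_max_right _ _).trans ht.le) _) hx).trans_lt hte⟩
  have hlin : ∀ ε > 0, ∃ y : Fin (n+1) → ℤ, (∃ i : Fin n, y i.succ ≠ 0) ∧ |linForm θ y| ≤ ε := by
    intro ε hε
    obtain ⟨t, ht, hte⟩ := hsmall w₁ hw₁ ε hε TL
    obtain ⟨y, hy0, -, hy⟩ := hTL t ht
    exact ⟨y, hy0, hy.trans hte.le⟩
  have hnR : (1 : ℝ) ≤ n := by exact_mod_cast hn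
  obtain ⟨R, hR⟩ := exists_one_add_mul_one_sub_le_of_linked (c := Real.log (2 * n))
    (d := Real.log 2) hγ1 hγ0 hγ hw1 hw hlam hom (Real.log_nonneg (by linarith))
  set H : ℝ := max TL' (max (2 * TL) 2) with hH
  have hHpos : 0 < H := lt_of_lt_of_le two_pos ((le_max_right _ _).trans (le_max_right _ _))
  obtain ⟨K, hK⟩ := exists_nat_gt (max (max (Real.exp R) (max TS' (2 * TS))) (max 1 ((H + 1) ^ om)))
  simp only [max_lt_iff] at hK
  obtain ⟨⟨hKR, hKS', hKS⟩, hK1, hKH⟩ := hK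
  obtain ⟨X, X', h, y, hKX, hXX, hh, hrec, hy0, hyh, hyK, hmin, hA, hB⟩ :=
    exists_linked_approximations hn hindep hsim hlin (K := K) (by
      have : (0 : ℝ) < K := by linarith
      exact_mod_cast this)
  have hKXR : (K : ℝ) ≤ X := by exact_mod_cast hKX
  have hXXR : (X : ℝ) < X' := by exact_mod_cast hXX
  have hX0 : (0 : ℝ) < X := by linarith
  have hX0N : 0 < X := by exact_mod_cast hX0
  have hhR : (0 : ℝ) < h := by exact_mod_cast hh
  have hLpos : 0 < simErr θ X := simErr_pos hn hindep hX0N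
  have hMpos : 0 < |linForm θ y| := abs_pos.2 <| linForm_ne_zero hindep fun h0 => by
    obtain ⟨i, hi⟩ := hy0
    simp [h0] at hi
  have hHh : H < h := by
    by_contra! hle
    refine hTL' (H + 1) (by linarith [le_max_left TL' (max (2 * TL) 2)])
      ⟨y, hy0, fun i => ?_, ?_⟩
    · have : ((|y i.succ| : ℤ) : ℝ) ≤ h := by exact_mod_cast hyh i
      push_cast at this
      linarith
    · refine hyK.trans ?_
      rw [Real.rpow_neg (by linarith), ← one_div]
      exact one_div_le_one_div_of_le (Real.rpow_pos_of_pos (by linarith) _) (by linarith)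
  simp only [hH, max_lt_iff] at hHh
  obtain ⟨hhL', hhL, hh2⟩ := hHh
  have hsimX : simErr θ X ≤ (X' / 2 : ℝ) ^ (-γ₁) := by
    obtain ⟨x, hx0, hxt, hx⟩ := hTS (X' / 2) (by linarith)
    refine (hrec (x 0).natAbs (Int.natAbs_pos.2 hx0) ?_).trans
      (simErr_natAbs_le θ x (by positivity) hx)
    have h1 : (((x 0).natAbs : ℕ) : ℝ) = |(x 0 : ℝ)| := by
      rw [Nat.cast_natAbs, Int.cast_abs]
    have : (((x 0).natAbs : ℕ) : ℝ) < X' := by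
      rw [h1]
      linarith
    exact_mod_cast this
  have hlinh : 1 / (2 * X : ℝ) < (h / 2 : ℝ) ^ (-w₁) := by
    obtain ⟨y', hy'0, hy't, hy'⟩ := hTL (h / 2) (by linarith)
    refine (hmin y' hy'0 fun i => ?_).trans_le hy'
    have : ((|y' i.succ| : ℤ) : ℝ) < h := by
      push_cast
      linarith [hy't i]
    exact_mod_cast this
  have hsimX' : (X : ℝ) ^ (-lam₁) < simErr θ X := by
    by_contra! hle
    exact hTS' X (by linarith) (simSolvable_of_simErr_le hX0N le_rfl hle)
  have hlinh' : (h : ℝ) ^ (-om) < |linForm θ y| := by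
    by_contra! hle
    refine hTL' h hhL' ⟨y, hy0, fun i => ?_, hle⟩
    have := hyh i
    exact_mod_cast this
  refine hR (Real.log X) (-Real.log (simErr θ X)) (Real.log X') (-Real.log |linForm θ y|)
    (Real.log h) ?_ (Real.log_le_log hX0 hXXR.le) ?_ (Real.log_pos (by linarith)) ?_ ?_ ?_ ?_ ?_ ?_
  · rw [Real.le_log_iff_exp_le hX0]
    linarith
  · refine neg_pos.2 (Real.log_neg hMpos (hyK.trans_lt ?_))
    rw [div_lt_one (by linarith)]
    linarith
  · have := Real.log_le_log (by positivity) hlinh.le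
    rw [Real.log_rpow (by positivity), Real.log_div hhR.ne' two_ne_zero, one_div, Real.log_inv,
      Real.log_mul two_ne_zero hX0.ne'] at this
    linarith
  · have := Real.log_le_log hLpos hsimX
    rw [Real.log_rpow (by linarith), Real.log_div (by linarith) two_ne_zero] at this
    linarith
  · have := Real.log_le_log (by positivity) hsimX'.le
    rw [Real.log_rpow (by linarith)] at this
    linarith
  · have := Real.log_le_log (by positivity) hlinh'.le
    rw [Real.log_rpow (by linarith)] at this
    linarith
  · have := Real.log_le_log hX0 hA
    rw [Real.log_mul (by positivity) (by linarith), Real.log_mul (by positivity) (by positivity),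
      Real.log_mul (by positivity) (by positivity)] at this
    linarith
  · have := Real.log_le_log (by positivity) hB
    rw [Real.log_mul (by positivity) (by positivity), Real.log_mul (by positivity) (by positivity),
      Real.log_mul (by positivity) (by positivity)] at this
    linarith

theorem exists_abs_sub_int_le_of_card_lt {α ι : Type*} [Fintype ι] (s : Finset α) {H : ℕ}
    (hH : 0 < H) (f : α → ι → ℝ) (hcard : H ^ Fintype.card ι < s.card) :
    ∃ a ∈ s, ∃ b ∈ s, a ≠ b ∧
      ∀ i, |f a i - f b i - ((⌊f a i⌋ - ⌊f b i⌋ : ℤ) : ℝ)| ≤ (H : ℝ)⁻¹ := by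
  classical
  have hHR : (0 : ℝ) < H := by exact_mod_cast hH
  obtain ⟨a, ha, b, hb, hab, he⟩ := Finset.exists_ne_map_eq_of_card_lt_of_maps_to
    (s := s) (t := Fintype.piFinset fun _ : ι => Finset.range H)
    (f := fun a i => ⌊Int.fract (f a i) * H⌋₊) (by simpa using hcard) (fun a _ => by
      rw [Finset.mem_coe, Fintype.mem_piFinset]
      intro i
      rw [Finset.mem_range, Nat.floor_lt (by positivity)]
      exact mul_lt_of_lt_one_left hHR (Int.fract_lt_one _))
  refine ⟨a, ha, b, hb, hab, fun i => ?_⟩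
  have h1 := congrFun he i
  have h2 := Nat.floor_le (show 0 ≤ Int.fract (f a i) * H by positivity)
  have h3 := Nat.lt_floor_add_one (Int.fract (f a i) * H)
  have h4 := Nat.floor_le (show 0 ≤ Int.fract (f b i) * H by positivity)
  have h5 := Nat.lt_floor_add_one (Int.fract (f b i) * H)
  rw [h1] at h2 h3
  have h6 : f a i - f b i - ((⌊f a i⌋ - ⌊f b i⌋ : ℤ) : ℝ) =
      Int.fract (f a i) - Int.fract (f b i) := by
    rw [Int.fract, Int.fract]
    push_cast
    ring
  rw [h6, ← one_div, le_div_iff₀ hHR, ← abs_of_pos hHR, ← abs_mul, sub_mul, abs_le]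
  constructor <;> linarith

theorem half_le_natFloor {x : ℝ} (hx : 1 ≤ x) : x / 2 ≤ ⌊x⌋₊ := by
  have h1 := Nat.lt_floor_add_one x
  have h2 : (1 : ℝ) ≤ ⌊x⌋₊ := by exact_mod_cast (Nat.one_le_floor_iff x).2 hx
  linarith

theorem eventually_simSolvable {n : ℕ} (hn : 0 < n) (θ : Fin n → ℝ) {γ : ℝ}
    (hγ : γ < (n : ℝ)⁻¹) : ∃ T : ℝ, ∀ t, T < t → SimSolvable n θ γ t := by
  obtain ⟨T, hT⟩ := Filter.eventually_atTop.1
    ((tendsto_rpow_atTop (sub_pos.2 hγ)).eventually (Filter.eventually_ge_atTop 2))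
  refine ⟨max T 1, fun t ht => ?_⟩
  have ht1 : 1 < t := (le_max_right _ _).trans_lt ht
  have ht0 : 0 < t := by linarith
  have hTt := hT t ((le_max_left _ _).trans ht.le)
  have hroot : 1 ≤ t ^ (n : ℝ)⁻¹ := Real.one_le_rpow ht1.le (by positivity)
  have hhalf := half_le_natFloor hroot
  have hpow : (⌊t ^ (n : ℝ)⁻¹⌋₊ : ℝ) ^ n ≤ t := by
    calc _ ≤ (t ^ (n : ℝ)⁻¹) ^ n := by
          gcongr
          exact Nat.floor_le (by positivity)
      _ = t := Real.rpow_inv_natCast_pow ht0.le hn.ne'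
  have hpos : 0 < ⌊t ^ (n : ℝ)⁻¹⌋₊ := Nat.floor_pos.2 hroot
  set H := ⌊t ^ (n : ℝ)⁻¹⌋₊
  obtain ⟨a, ha, b, hb, hab, h⟩ := exists_abs_sub_int_le_of_card_lt (Finset.range (H ^ n + 1)) hpos
    (fun q (i : Fin n) => (q : ℝ) * θ i) (by simp)
  refine ⟨Fin.cons ((a : ℤ) - b) fun i => ⌊(a : ℝ) * θ i⌋ - ⌊(b : ℝ) * θ i⌋, ?_, ?_, fun i => ?_⟩
  · rw [Fin.cons_zero]
    omega
  · refine le_trans ?_ hpow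
    rw [Finset.mem_range] at ha hb
    have : |(a : ℤ) - b| ≤ (H ^ n : ℕ) := by
      rw [abs_le]
      omega
    rw [Fin.cons_zero]
    exact_mod_cast this
  · simp only [Fin.cons_zero, Fin.cons_succ]
    have h1 := h i
    rw [← sub_mul] at h1
    refine le_trans (by exact_mod_cast h1) ?_
    rw [Real.rpow_neg ht0.le]
    refine inv_anti₀ (by positivity) (le_trans ?_ hhalf)
    rw [Real.rpow_sub ht0, le_div_iff₀ (by positivity)] at hTt
    linarith

theorem eventually_linSolvable {n : ℕ} (hn : 0 < n) (θ : Fin n → ℝ) {w : ℝ} (hw : w < n) :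
    ∃ T : ℝ, ∀ t, T < t → LinSolvable n θ w t := by
  obtain ⟨T, hT⟩ := Filter.eventually_atTop.1
    ((tendsto_rpow_atTop (sub_pos.2 hw)).eventually (Filter.eventually_ge_atTop (2 ^ n)))
  refine ⟨max T 1, fun t ht => ?_⟩
  have ht1 : 1 < t := (le_max_right _ _).trans_lt ht
  have ht0 : 0 < t := by linarith
  have hTt := hT t ((le_max_left _ _).trans ht.le)
  have hhalf := half_le_natFloor ht1.le
  have hle := Nat.floor_le ht0.le
  have hpos : 0 < ⌊t⌋₊ := Nat.floor_pos.2 ht1.le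
  set H := ⌊t⌋₊
  obtain ⟨a, ha, b, hb, hab, h⟩ := exists_abs_sub_int_le_of_card_lt (ι := Unit)
    (Fintype.piFinset fun _ : Fin n => Finset.range (H + 1)) (pow_pos hpos n)
    (fun a _ => ∑ i, θ i * (a i : ℝ)) (by
      simpa using Nat.pow_lt_pow_left (Nat.lt_succ_self H) hn.ne')
  rw [Fintype.mem_piFinset] at ha hb
  refine ⟨Fin.cons (-(⌊∑ i, θ i * (a i : ℝ)⌋ - ⌊∑ i, θ i * (b i : ℝ)⌋))
    fun i => (a i : ℤ) - b i, ?_, fun i => ?_, ?_⟩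
  · obtain ⟨i, hi⟩ := Function.ne_iff.1 hab
    refine ⟨i, ?_⟩
    rw [Fin.cons_succ]
    omega
  · refine le_trans ?_ hle
    have h1 := Finset.mem_range.1 (ha i)
    have h2 := Finset.mem_range.1 (hb i)
    have : |(a i : ℤ) - b i| ≤ H := by
      rw [abs_le]
      omega
    rw [Fin.cons_succ]
    exact_mod_cast this
  · have h1 := h ()
    simp only [Fin.cons_zero, Fin.cons_succ]
    have h2 : ((-(⌊∑ i, θ i * (a i : ℝ)⌋ - ⌊∑ i, θ i * (b i : ℝ)⌋) : ℤ) : ℝ) +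
        ∑ i, θ i * (((a i : ℤ) - b i : ℤ) : ℝ) = ∑ i, θ i * (a i : ℝ) - ∑ i, θ i * (b i : ℝ) -
          ((⌊∑ i, θ i * (a i : ℝ)⌋ - ⌊∑ i, θ i * (b i : ℝ)⌋ : ℤ) : ℝ) := by
      push_cast
      simp only [mul_sub, Finset.sum_sub_distrib]
      ring
    rw [h2]
    refine h1.trans ?_
    rw [Real.rpow_neg ht0.le]
    refine inv_anti₀ (by positivity) ?_
    rw [Real.rpow_sub ht0, le_div_iff₀ (by positivity), Real.rpow_natCast] at hTt
    push_cast
    calc t ^ w ≤ (t / 2) ^ n := by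
          rw [div_pow, le_div_iff₀ (by positivity)]
          linarith
      _ ≤ _ := by gcongr

theorem geom_sum_le_of_le_Glin {n : ℕ} (hn : 2 ≤ n) {w g : ℝ} (hw : n ≤ w) (hg : 0 ≤ g)
    (hgw : g ≤ Glin n w) : ∑ i ∈ Finset.range n, g ^ i ≤ w := by
  have hw0 : 0 < w := lt_of_lt_of_le (by exact_mod_cast (show 0 < n by omega)) hw
  set A : Set ℝ := {x : ℝ | w⁻¹ * x ^ n - x + (1 - w⁻¹) = 0} with hA
  have hroot : ∀ x ∈ A, 1 ≤ x → ∑ i ∈ Finset.range n, x ^ i ≤ w := by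
    intro x hx hx1
    rcases hx1.eq_or_lt with rfl | hx1
    · simpa using hw
    · have h1 := geom_sum_mul x n
      have h2 : w⁻¹ * x ^ n - x + (1 - w⁻¹) = 0 := hx
      have h3 : (w⁻¹ * ∑ i ∈ Finset.range n, x ^ i) * (x - 1) = 1 * (x - 1) := by
        rw [mul_assoc, h1]
        linarith
      have h4 := mul_right_cancel₀ (by linarith : x - 1 ≠ 0) h3
      rw [inv_mul_eq_one₀ hw0.ne'] at h4
      exact h4.ge
  have h1A : (1 : ℝ) ∈ A := by simp [hA]
  have hbdd : BddAbove A := by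
    refine ⟨max 1 w, fun x hx => ?_⟩
    rcases le_total x 1 with h | h
    · exact h.trans (le_max_left _ _)
    · refine le_trans ?_ ((hroot x hx h).trans (le_max_right _ _))
      calc x = x ^ 1 := (pow_one x).symm
        _ ≤ _ := Finset.single_le_sum (f := fun i => x ^ i) (fun i _ => by positivity)
          (Finset.mem_range.2 (by omega))
  have hclosed : IsClosed A := isClosed_eq (by fun_prop) continuous_const
  have hmem : Glin n w ∈ A := hclosed.csSup_mem ⟨1, h1A⟩ hbdd
  refine le_trans ?_ (hroot _ hmem (le_csSup hbdd h1A))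
  gcongr

theorem pow_le_mul_geom_sum_of_le_Gsim {n : ℕ} (hn : 2 ≤ n) {l g : ℝ} (hl : (n : ℝ)⁻¹ ≤ l)
    (hl1 : l < 1) (hg : 0 < g) (hgl : g ≤ Gsim n l) :
    g ^ (n - 1) ≤ l * ∑ i ∈ Finset.range n, g ^ i := by
  have hn0 : (0 : ℝ) < n := by exact_mod_cast (show 0 < n by omega)
  have hl0 : 0 < l := (inv_pos.2 hn0).trans_le hl
  set A : Set ℝ := {x : ℝ | (1 - l) * x ^ n - x ^ (n - 1) + l = 0} with hA
  have hsucc : ∀ x : ℝ, x ^ n = x ^ (n - 1) * x := fun x => by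
    rw [← pow_succ, Nat.sub_add_cancel (by omega)]
  have hroot : ∀ x ∈ A, 1 ≤ x → x ^ (n - 1) ≤ l * ∑ i ∈ Finset.range n, x ^ i := by
    intro x hx hx1
    rcases hx1.eq_or_lt with rfl | hx1
    · rw [inv_le_iff_one_le_mul₀ hn0] at hl
      simpa using hl
    · have h1 := geom_sum_mul x n
      have h2 : (1 - l) * x ^ n - x ^ (n - 1) + l = 0 := hx
      have h3 : x ^ (n - 1) * (x - 1) = (l * ∑ i ∈ Finset.range n, x ^ i) * (x - 1) := by
        rw [mul_assoc, h1]
        linarith [hsucc x]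
      exact (mul_right_cancel₀ (by linarith : x - 1 ≠ 0) h3).le
  have h1A : (1 : ℝ) ∈ A := by simp [hA]
  have hbdd : BddAbove A := by
    refine ⟨max 1 (1 - l)⁻¹, fun x hx => ?_⟩
    rcases le_total x 1 with h | h
    · exact h.trans (le_max_left _ _)
    · refine le_trans ?_ (le_max_right _ _)
      have h2 : (1 - l) * x ^ n - x ^ (n - 1) + l = 0 := hx
      rw [hsucc] at h2
      have h3 : 0 < x ^ (n - 1) := by positivity
      rw [← one_div, le_div_iff₀ (by linarith)]
      refine le_of_mul_le_mul_left ?_ h3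
      linarith
  have hclosed : IsClosed A := isClosed_eq (by fun_prop) continuous_const
  have hmem : Gsim n l ∈ A := hclosed.csSup_mem ⟨1, h1A⟩ hbdd
  have hG1 : 1 ≤ Gsim n l := le_csSup hbdd h1A
  have hG := hroot _ hmem hG1
  set G := Gsim n l
  have hcmp : (∑ i ∈ Finset.range n, G ^ i) * g ^ (n - 1) ≤
      (∑ i ∈ Finset.range n, g ^ i) * G ^ (n - 1) := by
    rw [Finset.sum_mul, Finset.sum_mul]
    refine Finset.sum_le_sum fun i hi => ?_
    have hi' := Finset.mem_range.1 hi
    obtain ⟨j, hj⟩ : ∃ j, n - 1 = i + j := ⟨n - 1 - i, by omega⟩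
    rw [hj, pow_add, pow_add]
    calc G ^ i * (g ^ i * g ^ j) ≤ G ^ i * (g ^ i * G ^ j) := by gcongr
      _ = _ := by ring
  refine le_of_mul_le_mul_right ?_ (by positivity : 0 < G ^ (n - 1))
  calc g ^ (n - 1) * G ^ (n - 1) ≤ g ^ (n - 1) * (l * ∑ i ∈ Finset.range n, G ^ i) := by gcongr
    _ = l * ((∑ i ∈ Finset.range n, G ^ i) * g ^ (n - 1)) := by ring
    _ ≤ l * ((∑ i ∈ Finset.range n, g ^ i) * G ^ (n - 1)) := by gcongr
    _ = _ := by ring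

theorem min_Glin_Gsim_le {n : ℕ} (hn : 2 ≤ n) {w l : ℝ} (hw : n ≤ w) (hl : (n : ℝ)⁻¹ ≤ l)
    (hl1 : l < 1) : min (Glin n w) (Gsim n l) ≤ (1 - w⁻¹) / (1 - l) := by
  have hn1 : (1 : ℝ) ≤ n := by exact_mod_cast (show 1 ≤ n by omega)
  have hl' : 0 < 1 - l := sub_pos.2 hl1
  rcases le_or_gt (min (Glin n w) (Gsim n l)) 0 with h0 | h0
  · exact h0.trans (div_nonneg (sub_nonneg.2 (inv_le_one_of_one_le₀ (hn1.trans hw))) hl'.le)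
  have h1 := geom_sum_le_of_le_Glin hn hw h0.le (min_le_left _ _)
  have h2 := pow_le_mul_geom_sum_of_le_Gsim hn hl hl1 h0 (min_le_right _ _)
  set g := min (Glin n w) (Gsim n l)
  obtain ⟨k, rfl⟩ : ∃ k, n = k + 1 := ⟨n - 1, by omega⟩
  have h3 := geom_sum_succ (x := g) (n := k)
  have h4 := Finset.sum_range_succ (fun i => g ^ i) k
  rw [Nat.add_sub_cancel] at h2
  set S := ∑ i ∈ Finset.range (k + 1), g ^ i
  set S' := ∑ i ∈ Finset.range k, g ^ i
  have hS' : 0 ≤ S' := Finset.sum_nonneg fun i _ => by positivity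
  have hS : 0 < S := by nlinarith
  rw [le_div_iff₀ hl']
  have h5 : w⁻¹ ≤ S⁻¹ := inv_anti₀ hS h1
  have h6 : (1 - l) * S ≤ S' := by linarith
  have h7 : g * (1 - l) ≤ 1 - S⁻¹ := by
    refine le_of_mul_le_mul_right ?_ hS
    rw [sub_mul, inv_mul_cancel₀ hS.ne']
    nlinarith
  linarith

theorem le_toReal_sSup {Q : ℝ → Prop} {γ : ℝ} (hγ : 0 < γ) (hQ : Q γ)
    (htop : sSup {e : ℝ≥0∞ | ∃ γ : ℝ, 0 < γ ∧ e = ENNReal.ofReal γ ∧ Q γ} ≠ ⊤) :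
    γ ≤ (sSup {e : ℝ≥0∞ | ∃ γ : ℝ, 0 < γ ∧ e = ENNReal.ofReal γ ∧ Q γ}).toReal :=
  (ENNReal.ofReal_le_iff_le_toReal htop).1 (le_sSup ⟨γ, hγ, rfl, hQ⟩)

theorem exists_lt_of_lt_toReal_sSup {Q : ℝ → Prop} {c : ℝ} (hc : 0 ≤ c)
    (h : c < (sSup {e : ℝ≥0∞ | ∃ γ : ℝ, 0 < γ ∧ e = ENNReal.ofReal γ ∧ Q γ}).toReal) :
    ∃ γ, c < γ ∧ Q γ := by
  obtain ⟨-, ⟨γ, hγ, rfl, hQ⟩, hlt⟩ := lt_sSup_iff.1 ((ENNReal.ofReal_lt_iff_lt_toReal hc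
    (fun htop => by
      rw [htop, ENNReal.toReal_top] at h
      linarith)).2 h)
  exact ⟨γ, (ENNReal.ofReal_lt_ofReal_iff hγ).1 hlt, hQ⟩

theorem lambdaHatExp_toReal_ge {n : ℕ} (hn : 0 < n) {θ : Fin n → ℝ} (h : lambdaHatExp n θ ≠ ⊤) :
    (n : ℝ)⁻¹ ≤ (lambdaHatExp n θ).toReal := by
  have hn0 : (0 : ℝ) < (n : ℝ)⁻¹ := inv_pos.2 (by exact_mod_cast hn)
  refine le_of_forall_lt fun c hc => ?_
  obtain ⟨γ, hγ, hγn⟩ := exists_between (max_lt hc hn0)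
  rw [max_lt_iff] at hγ
  exact hγ.1.trans_le (le_toReal_sSup (Q := fun γ => ∃ T : ℝ, ∀ t : ℝ, T < t → SimSolvable n θ γ t)
    hγ.2 (eventually_simSolvable hn θ hγn) h)

theorem omegaHatExp_toReal_ge {n : ℕ} (hn : 0 < n) {θ : Fin n → ℝ} (h : omegaHatExp n θ ≠ ⊤) :
    (n : ℝ) ≤ (omegaHatExp n θ).toReal := by
  have hn0 : (0 : ℝ) < (n : ℝ) := by exact_mod_cast hn
  refine le_of_forall_lt fun c hc => ?_
  obtain ⟨γ, hγ, hγn⟩ := exists_between (max_lt hc hn0)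
  rw [max_lt_iff] at hγ
  exact hγ.1.trans_le (le_toReal_sSup (Q := fun γ => ∃ T : ℝ, ∀ t : ℝ, T < t → LinSolvable n θ γ t)
    hγ.2 (eventually_linSolvable hn θ hγn) h)

theorem omegaHatExp_le_omegaExp (n : ℕ) (θ : Fin n → ℝ) : omegaHatExp n θ ≤ omegaExp n θ := by
  refine sSup_le_sSup ?_
  rintro e ⟨γ, hγ, he, T, hT⟩
  exact ⟨γ, hγ, he, fun S => ⟨max S T + 1, (le_max_left S T).trans_lt (lt_add_one _),
    hT _ ((le_max_right S T).trans_lt (lt_add_one _))⟩⟩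

theorem one_add_omegaExp_mul_le {n : ℕ} (hn : 2 ≤ n) {θ : Fin n → ℝ}
    (hindep : LinearIndependent ℚ (Fin.cons 1 θ : Fin (n+1) → ℝ)) (hω : omegaExp n θ ≠ ⊤)
    (hlamhat : lambdaHatExp n θ < 1) (hlam : lambdaExp n θ ≠ ⊤) :
    (1 + (omegaExp n θ).toReal⁻¹) * (1 - (omegaHatExp n θ).toReal⁻¹) ≤
      (1 + (lambdaExp n θ).toReal) * (1 - (lambdaHatExp n θ).toReal) := by
  have homhat := ne_top_of_le_ne_top hω (omegaHatExp_le_omegaExp n θ)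
  have hn2 : (2 : ℝ) ≤ n := by exact_mod_cast hn
  have hn0 : 0 < n := by omega
  have hl := lambdaHatExp_toReal_ge hn0 hlamhat.ne_top
  have hw := omegaHatExp_toReal_ge hn0 homhat
  have hww := ENNReal.toReal_mono hω (omegaHatExp_le_omegaExp n θ)
  have hl1 : (lambdaHatExp n θ).toReal ≤ 1 := by
    simpa using ENNReal.toReal_mono ENNReal.one_ne_top hlamhat.le
  have hsim : ∀ γ, 0 < γ → (lambdaExp n θ).toReal < γ →
      ∃ T : ℝ, ∀ t, T < t → ¬ SimSolvable n θ γ t := by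
    intro γ hγ hlt
    by_contra! h
    exact hlt.not_ge (le_toReal_sSup
      (Q := fun γ => ∀ T : ℝ, ∃ t : ℝ, T < t ∧ SimSolvable n θ γ t) hγ h hlam)
  have hlin : ∀ γ, 0 < γ → (omegaExp n θ).toReal < γ →
      ∃ T : ℝ, ∀ t, T < t → ¬ LinSolvable n θ γ t := by
    intro γ hγ hlt
    by_contra! h
    exact hlt.not_ge (le_toReal_sSup
      (Q := fun γ => ∀ T : ℝ, ∃ t : ℝ, T < t ∧ LinSolvable n θ γ t) hγ h hω)
  have hsimhat : ∀ c, 0 ≤ c → c < (lambdaHatExp n θ).toReal →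
      ∃ γ, c < γ ∧ ∃ T : ℝ, ∀ t, T < t → SimSolvable n θ γ t :=
    fun c hc h => exists_lt_of_lt_toReal_sSup hc h
  have hlinhat : ∀ c, 0 ≤ c → c < (omegaHatExp n θ).toReal →
      ∃ γ, c < γ ∧ ∃ T : ℝ, ∀ t, T < t → LinSolvable n θ γ t :=
    fun c hc h => exists_lt_of_lt_toReal_sSup hc h
  have hlam0 : 0 ≤ (lambdaExp n θ).toReal := ENNReal.toReal_nonneg
  generalize (lambdaHatExp n θ).toReal = l at *
  generalize (omegaHatExp n θ).toReal = w at *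
  generalize (lambdaExp n θ).toReal = L at *
  generalize (omegaExp n θ).toReal = W at *
  have hl0 : 0 < l := (inv_pos.2 (by linarith)).trans_le hl
  have hleft : Filter.Tendsto (fun ε : ℝ => (1 + (W + ε)⁻¹) * (1 - (w - ε)⁻¹))
      (nhdsWithin 0 (Set.Ioi 0)) (nhds ((1 + W⁻¹) * (1 - w⁻¹))) := by
    have : ContinuousAt (fun ε : ℝ => (1 + (W + ε)⁻¹) * (1 - (w - ε)⁻¹)) 0 := by
      fun_prop (disch := first | (simp; linarith))
    simpa using this.tendsto.mono_left nhdsWithin_le_nhds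
  have hright : Filter.Tendsto (fun ε : ℝ => (1 + (L + 2 * ε)) * (1 - (l - ε)))
      (nhdsWithin 0 (Set.Ioi 0)) (nhds ((1 + L) * (1 - l))) := by
    have : ContinuousAt (fun ε : ℝ => (1 + (L + 2 * ε)) * (1 - (l - ε))) 0 := by fun_prop
    simpa using this.tendsto.mono_left nhdsWithin_le_nhds
  refine le_of_tendsto_of_tendsto hleft hright ?_
  filter_upwards [Ioo_mem_nhdsGT (lt_min hl0 one_pos)] with ε hε
  obtain ⟨hε0, hε1⟩ := hε
  rw [lt_min_iff] at hε1
  obtain ⟨γ₁, hγ₁, hS⟩ := hsimhat (l - ε) (by linarith) (by linarith)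
  obtain ⟨w₁, hw₁, hL⟩ := hlinhat (w - ε) (by linarith) (by linarith)
  exact one_add_mul_one_sub_le hn0 hindep (by linarith) (by linarith) hγ₁ (by linarith) hw₁
    (show L + ε < L + 2 * ε by linarith) (by linarith) hS hL (hsim _ (by linarith) (by linarith))
    (hlin _ (by linarith) (by linarith))

/-- if `1, θ₁, …, θₙ` are linearly independent over `ℚ`, `ω < ∞`, `ω̂ < ∞` and
`λ̂ < 1`, then `B(ω,λ) ≥ A(ω̂,λ̂) ≥ min(G_lin(ω̂), G_sim(λ̂))`, where
`B(ω,λ) = (1+λ)/(1+ω⁻¹)` and `A(ω̂,λ̂) = (1-ω̂⁻¹)/(1-λ̂)`. -/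
theorem stmt12 (n : ℕ) (hn : 2 ≤ n) (θ : Fin n → ℝ)
    (hindep : LinearIndependent ℚ (Fin.cons 1 θ : Fin (n+1) → ℝ))
    (hω : omegaExp n θ < ⊤) (homhat : omegaHatExp n θ < ⊤) (hlamhat : lambdaHatExp n θ < 1) :
    (1 + lambdaExp n θ) / (1 + (omegaExp n θ)⁻¹) ≥
      (1 - (omegaHatExp n θ)⁻¹) / (1 - lambdaHatExp n θ) ∧
    (1 - (omegaHatExp n θ)⁻¹) / (1 - lambdaHatExp n θ) ≥
      ENNReal.ofReal
        (min (Glin n (omegaHatExp n θ).toReal) (Gsim n (lambdaHatExp n θ).toReal)) := by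
  have hn0 : 0 < n := by omega
  have hn2 : (2 : ℝ) ≤ n := by exact_mod_cast hn
  have hl := lambdaHatExp_toReal_ge hn0 hlamhat.ne_top
  have hw := omegaHatExp_toReal_ge hn0 homhat.ne
  have hww := ENNReal.toReal_mono hω.ne (omegaHatExp_le_omegaExp n θ)
  have hl1 : (lambdaHatExp n θ).toReal < 1 := by
    simpa using (ENNReal.toReal_lt_toReal hlamhat.ne_top ENNReal.one_ne_top).2 hlamhat
  have hB := one_add_omegaExp_mul_le hn hindep hω.ne hlamhat
  have hL0 : 0 ≤ (lambdaExp n θ).toReal := ENNReal.toReal_nonneg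
  rw [← ENNReal.ofReal_toReal hω.ne, ← ENNReal.ofReal_toReal homhat.ne,
    ← ENNReal.ofReal_toReal hlamhat.ne_top, ENNReal.toReal_ofReal ENNReal.toReal_nonneg,
    ENNReal.toReal_ofReal ENNReal.toReal_nonneg]
  have hA := min_Glin_Gsim_le hn hw hl hl1
  generalize (lambdaHatExp n θ).toReal = l at *
  generalize (omegaHatExp n θ).toReal = w at *
  generalize (omegaExp n θ).toReal = W at *
  have hl0 : 0 ≤ l := (inv_nonneg.2 (by linarith)).trans hl
  have hw0 : 0 < w := by linarith
  have hW0 : 0 < W := by linarith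
  have hAeq : (1 - (ENNReal.ofReal w)⁻¹) / (1 - ENNReal.ofReal l) =
      ENNReal.ofReal ((1 - w⁻¹) / (1 - l)) := by
    rw [ENNReal.ofReal_div_of_pos (by linarith), ENNReal.ofReal_sub _ (by positivity),
      ENNReal.ofReal_sub _ hl0, ENNReal.ofReal_one, ENNReal.ofReal_inv_of_pos hw0]
  have hden : 1 + (ENNReal.ofReal W)⁻¹ = ENNReal.ofReal (1 + W⁻¹) := by
    rw [ENNReal.ofReal_add zero_le_one (by positivity), ENNReal.ofReal_one,
      ENNReal.ofReal_inv_of_pos hW0]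
  rw [hAeq, hden]
  refine ⟨?_, ENNReal.ofReal_le_ofReal hA⟩
  by_cases hlam : lambdaExp n θ = ⊤
  · rw [hlam, add_top, ENNReal.top_div_of_ne_top ENNReal.ofReal_ne_top]
    exact le_top
  · rw [← ENNReal.ofReal_toReal hlam, ← ENNReal.ofReal_one,
      ← ENNReal.ofReal_add zero_le_one hL0, ← ENNReal.ofReal_div_of_pos (by positivity)]
    refine ENNReal.ofReal_le_ofReal ?_
    rw [div_le_div_iff₀ (by linarith) (by positivity)]
    linarith [hB hlam]
end
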